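/- arXiv:0910.2531 — 3 statements merged into one kernel-verified Lean document; each statement's English description precedes it below -/
import Mathlib

section
/- Let N ≥ 1 be an integer and let X₁, X₂ be independent N×N random real matrices whose entries are independent standard Gaussians (mean 0, variance 1). Then the expected number of real generalised eigenvalues, i.e. the integral over pairs (X₁, X₂) of the cardinality of the set {λ ∈ ℝ : det(X₁ − λ X₂) = 0} (this set is almost surely finite, with at most N elements), equals E_N = √π · Γ((N+1)/2)/Γ(N/2). -/
open MeasureTheory ProbabilityTheory Real Matrix

section AreaFormula

open Set ENNReal NNReal

variable {E : Type*} [NormedAddCommGroup E] [NormedSpace ℝ E] [FiniteDimensional ℝ E]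
  [MeasurableSpace E] [BorelSpace E] (ν : Measure E) [ν.IsAddHaarMeasure]

/-- The area formula with multiplicities for a `C¹` self-map of a finite-dimensional space. -/
theorem lintegral_mul_count_preimage {f : E → E} {f' : E → E →L[ℝ] E}
    (hf : ∀ x, HasFDerivAt f (f' x) x) (hf' : Continuous f') {g : E → ℝ≥0∞} (hg : Measurable g) :
    ∫⁻ x, g x * Measure.count (f ⁻¹' {x}) ∂ν = ∫⁻ u, ENNReal.ofReal |(f' u).det| * g (f u) ∂ν := by
  classical
  have hcont : Continuous f := continuous_iff_continuousAt.2 fun x => (hf x).continuousAt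
  set U : Set E := {u | (f' u).det ≠ 0} with hU
  have hUm : MeasurableSet U :=
    (isOpen_ne_fun (ContinuousLinearMap.continuous_det.comp hf') continuous_const).measurableSet
  let r : (E →L[ℝ] E) → ℝ≥0 := fun A =>
    if h : A.det ≠ 0 then
      if Subsingleton E then 1 else
      ‖((A.toContinuousLinearEquivOfDetNeZero h).symm : E →L[ℝ] E)‖₊⁻¹ / 2
    else 1
  have hr : ∀ A, r A ≠ 0 := by
    intro A
    simp only [r]
    split_ifs with h1 h2
    · simp
    · have : Nontrivial E := not_subsingleton_iff_nontrivial.1 h2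
      have := (A.toContinuousLinearEquivOfDetNeZero h1).nnnorm_symm_pos
      positivity
    · simp
  obtain ⟨t, A, htd, htm, htU, hta, htA⟩ :=
    exists_partition_approximatesLinearOn_of_hasFDerivWithinAt
    f U f' (fun x _ => (hf x).hasFDerivWithinAt) r hr
  have hinj : ∀ n, InjOn f (U ∩ t n) := by
    intro n
    rcases U.eq_empty_or_nonempty with hE | hne
    · simp [hE]
    obtain ⟨y, hy, hAy⟩ := htA hne n
    have hd : (A n).det ≠ 0 := by rw [hAy]; exact hy
    have h := hta n
    have : ApproximatesLinearOn f
        (((A n).toContinuousLinearEquivOfDetNeZero hd : E ≃L[ℝ] E) : E →L[ℝ] E) (U ∩ t n)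
        (r (A n)) := by simpa using h
    refine this.injOn ?_
    by_cases hs : Subsingleton E
    · exact Or.inl hs
    · right
      have : Nontrivial E := not_subsingleton_iff_nontrivial.1 hs
      have h0 := ((A n).toContinuousLinearEquivOfDetNeZero hd).nnnorm_symm_pos
      simp only [r, dif_pos hd, if_neg hs]
      exact NNReal.half_lt_self (by positivity)
  have hUt : U = ⋃ n, U ∩ t n := by
    rw [← inter_iUnion]; exact (inter_eq_left.2 htU).symm
  have hdisj : Pairwise (Function.onFun Disjoint fun n => U ∩ t n) := fun i j hij =>
    (htd hij).mono inter_subset_right inter_subset_right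
  have hmeas : ∀ n, MeasurableSet (U ∩ t n) := fun n => hUm.inter (htm n)
  have himg : ∀ n, MeasurableSet (f '' (U ∩ t n)) := fun n =>
    measurable_image_of_fderivWithin (hmeas n) (fun x _ => (hf x).hasFDerivWithinAt) (hinj n)
  have hcrit : ν (f '' Uᶜ) = 0 :=
    addHaar_image_eq_zero_of_det_fderivWithin_eq_zero ν
      (fun x _ => (hf x).hasFDerivWithinAt) (fun x hx => by simpa [U] using hx)
  have hcount : ∀ᵐ x ∂ν, g x * Measure.count (f ⁻¹' {x}) =
      ∑' n, (f '' (U ∩ t n)).indicator g x := by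
    filter_upwards [measure_eq_zero_iff_ae_notMem.1 hcrit] with x hx
    have hsub : f ⁻¹' {x} = ⋃ n, (U ∩ t n) ∩ f ⁻¹' {x} := by
      rw [← iUnion_inter, ← hUt]
      refine (inter_eq_right.2 fun u hu => ?_).symm
      by_contra hcon
      exact hx ⟨u, hcon, hu⟩
    have hm1 : MeasurableSet (f ⁻¹' {x}) := hcont.measurable (measurableSet_singleton x)
    rw [hsub, measure_iUnion (fun i j hij => (hdisj hij).mono inter_subset_left inter_subset_left)
      (fun n => (hmeas n).inter hm1), ← ENNReal.tsum_mul_left]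
    refine tsum_congr fun n => ?_
    by_cases hxn : x ∈ f '' (U ∩ t n)
    · obtain ⟨u, hu, rfl⟩ := hxn
      have : (U ∩ t n) ∩ f ⁻¹' {f u} = {u} := by
        ext w
        constructor
        · rintro ⟨hw, hw'⟩
          exact hinj n hw hu hw'
        · rintro rfl
          exact ⟨hu, rfl⟩
      rw [this, Measure.count_singleton, mul_one, indicator_of_mem (mem_image_of_mem f hu)]
    · have : (U ∩ t n) ∩ f ⁻¹' {x} = ∅ := by
        ext w
        simp only [mem_inter_iff, mem_preimage, mem_singleton_iff, mem_empty_iff_false, iff_false]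
        rintro ⟨hw, hw'⟩
        exact hxn ⟨w, hw, hw'⟩
      rw [this, measure_empty, mul_zero, indicator_of_notMem hxn]
  rw [lintegral_congr_ae hcount, lintegral_tsum fun n => (hg.indicator (himg n)).aemeasurable]
  have hterm : ∀ n, ∫⁻ x, (f '' (U ∩ t n)).indicator g x ∂ν =
      ∫⁻ u in U ∩ t n, ENNReal.ofReal |(f' u).det| * g (f u) ∂ν := fun n => by
    rw [lintegral_indicator (himg n),
      lintegral_image_eq_lintegral_abs_det_fderiv_mul ν (hmeas n)
        (fun x _ => (hf x).hasFDerivWithinAt) (hinj n)]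
  simp_rw [hterm]
  rw [← lintegral_iUnion hmeas hdisj, ← hUt, ← lintegral_indicator hUm]
  refine lintegral_congr fun u => ?_
  by_cases hu : u ∈ U
  · rw [indicator_of_mem hu]
  · rw [indicator_of_notMem hu]
    have : (f' u).det = 0 := by simpa [U] using hu
    simp [this]

end AreaFormula

section Measurability

open Set ENNReal

variable {P : Type*} [TopologicalSpace P]

theorem isClosed_exists_mem_compact {Y Z : Type*} [TopologicalSpace Y] [TopologicalSpace Z]
    [T1Space Z] {K : Set Y} (hK : IsCompact K) {F : P × Y → Z} (hF : Continuous F) (z : Z) :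
    IsClosed {p : P | ∃ y ∈ K, F (p, y) = z} := by
  have : CompactSpace K := isCompact_iff_compactSpace.1 hK
  have h : IsClosed {q : P × K | F (q.1, q.2) = z} :=
    isClosed_singleton.preimage (hF.comp
      (by fun_prop : Continuous fun q : P × K => (q.1, (q.2 : Y))))
  convert isClosedMap_fst_of_compactSpace _ h using 1
  ext p
  simp

variable [MeasurableSpace P] [BorelSpace P]

/-- The number of real zeros of a function depending continuously on a parameter is a measurable
function of the parameter. -/
theorem measurable_count_zeros {F : P × ℝ → ℝ} (hF : Continuous F) :
    Measurable fun p => Measure.count {t : ℝ | F (p, t) = 0} := by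
  have hcl : ∀ p, MeasurableSet {t : ℝ | F (p, t) = 0} := fun p =>
    (isClosed_singleton.preimage
      (hF.comp (by fun_prop : Continuous fun t : ℝ => (p, t)))).measurableSet
  have key : ∀ k : ℕ, MeasurableSet {p | (k : ℕ∞) ≤ {t : ℝ | F (p, t) = 0}.encard} := by
    intro k
    have : {p | (k : ℕ∞) ≤ {t : ℝ | F (p, t) = 0}.encard} =
        ⋃ (q : Fin k → ℚ × ℚ) (_ : ∀ i j, i ≠ j →
          Disjoint (Icc ((q i).1 : ℝ) (q i).2) (Icc ((q j).1 : ℝ) (q j).2)),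
          ⋂ i, {p | ∃ t ∈ Icc ((q i).1 : ℝ) (q i).2, F (p, t) = 0} := by
      ext p
      simp only [mem_ofPred_eq, mem_iUnion, mem_iInter]
      constructor
      · intro h
        obtain ⟨s, hs, hsk⟩ := Set.exists_subset_encard_eq h
        have hfin : s.Finite := Set.finite_of_encard_eq_coe hsk
        have : Fintype s := hfin.fintype
        have hc : Fintype.card s = k := by
          rw [Set.encard_eq_coe_toFinset_card, Nat.cast_inj] at hsk
          simpa only [Set.toFinset_card] using hsk
        let e : Fin k ≃ s := (Fintype.equivFinOfCardEq hc).symm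
        have hev : ∀ᶠ δ in nhdsWithin (0 : ℝ) (Ioi 0), ∀ i j : Fin k, i ≠ j →
            2 * δ < |(e i : ℝ) - e j| := by
          simp only [Filter.eventually_all]
          intro i j hij
          have h0 : (0 : ℝ) < |(e i : ℝ) - e j| := by
            rw [abs_pos, sub_ne_zero]
            exact fun h => hij (e.injective (Subtype.ext h))
          have : Filter.Tendsto (fun δ : ℝ => 2 * δ) (nhdsWithin (0 : ℝ) (Ioi 0)) (nhds 0) := by
            have : Filter.Tendsto (fun δ : ℝ => 2 * δ) (nhds 0) (nhds (2 * 0)) :=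
              (continuous_const.mul continuous_id).tendsto 0
            rw [mul_zero] at this
            exact this.mono_left nhdsWithin_le_nhds
          exact this.eventually_lt_const h0
        obtain ⟨δ, hδ, hδ0⟩ := (hev.and self_mem_nhdsWithin).exists
        have hδ0 : 0 < δ := hδ0
        choose a ha using fun i : Fin k => exists_rat_btwn (show (e i : ℝ) - δ < e i by linarith)
        choose b hb using fun i : Fin k => exists_rat_btwn (show (e i : ℝ) < e i + δ by linarith)
        refine ⟨fun i => (a i, b i), fun i j hij => ?_, fun i => ⟨e i, ⟨(ha i).2.le, (hb i).1.le⟩,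
          hs (e i).2⟩⟩
        rw [Set.disjoint_left]
        rintro x ⟨h1, h2⟩ ⟨h3, h4⟩
        have := hδ i j hij
        have := ha i; have := ha j; have := hb i; have := hb j
        rcases abs_cases ((e i : ℝ) - e j) with h | h <;> dsimp only at * <;> linarith
      · rintro ⟨q, hq, h⟩
        choose t ht ht' using h
        have hinj : Function.Injective t := by
          intro i j hij
          by_contra hne
          exact (Set.disjoint_left.1 (hq i j hne) (ht i)) (hij ▸ ht j)
        have hk : (k : ℕ∞) = (range t).encard := by
          rw [← image_univ, hinj.encard_image, Set.encard_univ]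
          simp
        rw [hk]
        exact Set.encard_le_encard (by rintro _ ⟨i, rfl⟩; exact ht' i)
    rw [this]
    refine MeasurableSet.iUnion fun q => MeasurableSet.iUnion fun _ => MeasurableSet.iInter fun i =>
      (isClosed_exists_mem_compact isCompact_Icc hF 0).measurableSet
  simp_rw [fun p => Measure.count_apply (hcl p)]
  refine measurable_of_Ici fun a => ?_
  rcases eq_or_ne a ⊤ with rfl | ha
  · have : (fun p => ({t : ℝ | F (p, t) = 0}.encard : ℝ≥0∞)) ⁻¹' Ici ⊤ =
        ⋂ k : ℕ, {p | (k : ℕ∞) ≤ {t : ℝ | F (p, t) = 0}.encard} := by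
      ext p
      simp only [mem_preimage, mem_Ici, mem_iInter, mem_ofPred_eq, top_le_iff,
        ENat.toENNReal_eq_top]
      exact ENat.eq_top_iff_forall_ge
    rw [this]
    exact MeasurableSet.iInter key
  · have : (fun p => ({t : ℝ | F (p, t) = 0}.encard : ℝ≥0∞)) ⁻¹' Ici a =
        ⋃ (k : ℕ) (_ : a ≤ k), {p | (k : ℕ∞) ≤ {t : ℝ | F (p, t) = 0}.encard} := by
      ext p
      simp only [mem_preimage, mem_Ici, mem_iUnion, mem_ofPred_eq, exists_prop]
      constructor
      · intro h
        rcases eq_or_ne {t : ℝ | F (p, t) = 0}.encard ⊤ with htop | hne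
        · obtain ⟨k, hk⟩ := ENNReal.exists_nat_gt ha
          exact ⟨k, hk.le, by rw [htop]; exact le_top⟩
        · obtain ⟨k, hk⟩ := ENat.ne_top_iff_exists.1 hne
          rw [← hk] at h ⊢
          exact ⟨k, by simpa using h, le_rfl⟩
      · rintro ⟨k, hak, hk⟩
        exact hak.trans (by simpa using ENat.toENNReal_le.2 hk)
    rw [this]
    exact MeasurableSet.iUnion fun k => MeasurableSet.iUnion fun _ => key k

end Measurability

section GaussianMatrix

open ENNReal

theorem lintegral_pi_fin_prod {X : Type*} [MeasurableSpace X] (ν : Measure X) [SigmaFinite ν]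
    {n : ℕ} {f : Fin n → X → ℝ≥0∞} (hf : ∀ i, Measurable (f i)) :
    ∫⁻ x, ∏ i, f i (x i) ∂Measure.pi (fun _ : Fin n => ν) = ∏ i, ∫⁻ x, f i x ∂ν := by
  induction n with
  | zero => simp [lintegral_unique]
  | succ n ih =>
    rw [← (measurePreserving_piFinSuccAbove (fun _ : Fin (n + 1) => ν) 0).symm.lintegral_comp_emb
      (MeasurableEquiv.measurableEmbedding _), Fin.prod_univ_succ, ← ih fun i => hf i.succ,
      ← lintegral_prod_mul (hf 0).aemeasurable
        (Finset.measurable_prod _ fun i _ => (hf i.succ).comp (measurable_pi_apply i)).aemeasurable]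
    refine lintegral_congr fun x => ?_
    simp [Fin.prod_univ_succ, MeasurableEquiv.piFinSuccAbove]

theorem pi_fin_withDensity {X : Type*} [MeasurableSpace X] (ν : Measure X) [SigmaFinite ν]
    {n : ℕ} {f : X → ℝ≥0∞} (hf : Measurable f) [SigmaFinite (ν.withDensity f)] :
    Measure.pi (fun _ : Fin n => ν.withDensity f) =
      (Measure.pi fun _ : Fin n => ν).withDensity fun x => ∏ i, f (x i) := by
  refine Measure.pi_eq fun s hs => ?_
  rw [withDensity_apply _ (MeasurableSet.univ_pi hs),
    ← lintegral_indicator (MeasurableSet.univ_pi hs)]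
  have : ∀ x : Fin n → X, (Set.univ.pi s).indicator (fun x => ∏ i, f (x i)) x =
      ∏ i, (s i).indicator f (x i) := by
    intro x
    by_cases hx : x ∈ Set.univ.pi s
    · rw [Set.indicator_of_mem hx]
      exact Finset.prod_congr rfl fun i _ => (Set.indicator_of_mem (hx i trivial) _).symm
    · rw [Set.indicator_of_notMem hx]
      have : ∃ i, x i ∉ s i := by simpa [Set.mem_pi] using hx
      obtain ⟨i, hi⟩ := this
      exact (Finset.prod_eq_zero (Finset.mem_univ i) (Set.indicator_of_notMem hi _)).symm
  simp_rw [this]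
  rw [lintegral_pi_fin_prod ν fun i => hf.indicator (hs i)]
  refine Finset.prod_congr rfl fun i _ => ?_
  rw [lintegral_indicator (hs i), withDensity_apply _ (hs i)]

/-- The density of the standard Gaussian measure on `Fin k → ℝ`. -/
noncomputable def stdGaussianPDF {k : ℕ} (x : Fin k → ℝ) : ℝ≥0∞ := ∏ i, gaussianPDF 0 1 (x i)

theorem measurable_stdGaussianPDF {k : ℕ} : Measurable (stdGaussianPDF (k := k)) :=
  Finset.measurable_prod _ fun i _ => (measurable_gaussianPDF 0 1).comp (measurable_pi_apply i)

theorem stdGaussianPDF_eq {k : ℕ} (x : Fin k → ℝ) :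
    stdGaussianPDF x = ENNReal.ofReal ((√(2 * π))⁻¹ ^ k * rexp (-(x ⬝ᵥ x) / 2)) := by
  simp only [stdGaussianPDF, gaussianPDF]
  rw [← ENNReal.ofReal_prod_of_nonneg fun i _ => gaussianPDFReal_nonneg _ _ _]
  simp only [gaussianPDFReal, Finset.prod_mul_distrib, ← Real.exp_sum]
  congr 2
  · simp
  · congr 1
    simp only [dotProduct, ← Finset.sum_neg_distrib, Finset.sum_div]
    refine Finset.sum_congr rfl fun i _ => ?_
    simp; ring

theorem pi_gaussianReal_eq {k : ℕ} :
    (Measure.pi fun _ : Fin k => gaussianReal 0 1) = volume.withDensity stdGaussianPDF := by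
  have h : gaussianReal 0 1 = volume.withDensity (gaussianPDF 0 1) :=
    gaussianReal_of_var_ne_zero 0 one_ne_zero
  have : SigmaFinite (volume.withDensity (gaussianPDF 0 1)) := by rw [← h]; infer_instance
  rw [h, pi_fin_withDensity volume (measurable_gaussianPDF 0 1)]
  rfl

theorem pi_pi_gaussianReal_eq {m k : ℕ} :
    (Measure.pi fun _ : Fin m => Measure.pi fun _ : Fin k => gaussianReal 0 1) =
      volume.withDensity fun M => ∏ i, stdGaussianPDF (M i) := by
  have : SigmaFinite (volume.withDensity (stdGaussianPDF (k := k))) := by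
    rw [← pi_gaussianReal_eq]; infer_instance
  rw [pi_gaussianReal_eq, pi_fin_withDensity volume measurable_stdGaussianPDF]
  rfl

theorem lintegral_stdGaussianPDF {k : ℕ} : ∫⁻ x : Fin k → ℝ, stdGaussianPDF x = 1 := by
  have h : (Measure.pi fun _ : Fin k => gaussianReal 0 1) Set.univ = 1 := measure_univ
  rwa [pi_gaussianReal_eq, withDensity_apply _ MeasurableSet.univ, Measure.restrict_univ] at h

/-- Left multiplication by a matrix on `m × k` arrays scales Lebesgue measure by `|det R| ^ k`. -/
theorem lintegral_rows_mul {m k : ℕ} {R : Matrix (Fin m) (Fin m) ℝ} (hR : R.det ≠ 0)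
    (F : (Fin m → Fin k → ℝ) → ℝ≥0∞) :
    ∫⁻ M : Fin m → Fin k → ℝ, F (R * Matrix.of M : Matrix (Fin m) (Fin k) ℝ) =
      ENNReal.ofReal |(R.det ^ k)⁻¹| * ∫⁻ M : Fin m → Fin k → ℝ, F M := by
  let L : (Fin m → Fin k → ℝ) →ₗ[ℝ] (Fin m → Fin k → ℝ) := mulLeftLinearMap (Fin k) ℝ R
  have hL : LinearMap.det L = R.det ^ k := by
    let e : (Fin k → Fin m → ℝ) ≃ₗ[ℝ] (Fin m → Fin k → ℝ) :=
      Matrix.transposeLinearEquiv (Fin k) (Fin m) ℝ ℝ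
    let L' : (Fin k → Fin m → ℝ) →ₗ[ℝ] (Fin k → Fin m → ℝ) :=
      LinearMap.pi fun i => (Matrix.toLin' R).comp (LinearMap.proj i)
    have : L = (e : _ →ₗ[ℝ] _) ∘ₗ L' ∘ₗ (e.symm : _ →ₗ[ℝ] _) := by
      refine LinearMap.ext fun M => ?_
      rfl
    rw [this, LinearMap.det_conj, LinearMap.det_pi]
    simp
  have hL0 : LinearMap.det L ≠ 0 := by rw [hL]; exact pow_ne_zero _ hR
  have hmap := Measure.map_linearMap_addHaar_eq_smul_addHaar
    (volume : Measure (Fin m → Fin k → ℝ)) hL0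
  have hemb : MeasurableEmbedding L :=
    (L.equivOfDetNeZero hL0).toContinuousLinearEquiv.toHomeomorph.measurableEmbedding
  have := hemb.lintegral_map F (μ := volume)
  rw [hmap, lintegral_smul_measure, hL] at this
  exact this.symm

/-- The density of the standard Gaussian measure on `m × k` arrays. -/
noncomputable def stdGaussianMatrixPDF {m k : ℕ} (M : Matrix (Fin m) (Fin k) ℝ) : ℝ≥0∞ :=
  ∏ i, stdGaussianPDF (M i)

theorem measurable_stdGaussianMatrixPDF {m k : ℕ} :
    Measurable fun M : Fin m → Fin k → ℝ => stdGaussianMatrixPDF (Matrix.of M) :=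
  Finset.measurable_prod _ fun i _ => measurable_stdGaussianPDF.comp (measurable_pi_apply i)

theorem stdGaussianMatrixPDF_eq {m k : ℕ} (M : Matrix (Fin m) (Fin k) ℝ) :
    stdGaussianMatrixPDF M =
      ENNReal.ofReal ((√(2 * π))⁻¹ ^ (k * m) * rexp (-(∑ i, M i ⬝ᵥ M i) / 2)) := by
  simp only [stdGaussianMatrixPDF, stdGaussianPDF_eq]
  rw [← ENNReal.ofReal_prod_of_nonneg fun i _ => by positivity, Finset.prod_mul_distrib,
    ← Real.exp_sum, Finset.prod_const, Finset.card_univ, Fintype.card_fin, ← pow_mul]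
  congr 3
  rw [← Finset.sum_div, Finset.sum_neg_distrib]

theorem lintegral_stdGaussianMatrixPDF {m k : ℕ} :
    ∫⁻ M : Fin m → Fin k → ℝ, stdGaussianMatrixPDF (Matrix.of M) = 1 := by
  have := lintegral_pi_fin_prod (volume : Measure (Fin k → ℝ)) (n := m)
    (f := fun _ => stdGaussianPDF) fun _ => measurable_stdGaussianPDF
  simp only [lintegral_stdGaussianPDF, Finset.prod_const_one] at this
  exact this

theorem sum_dotProduct_rows {m k : ℕ} (M : Matrix (Fin m) (Fin k) ℝ) :
    ∑ i, M i ⬝ᵥ M i = (Mᵀ * M).trace := by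
  rw [Matrix.trace_mul_comm]
  rfl

/-- A square root of the rank one perturbation `1 + z zᵀ`. -/
theorem exists_sqrt_one_add_vecMulVec {m : ℕ} (z : Fin m → ℝ) :
    ∃ R : Matrix (Fin m) (Fin m) ℝ, |R.det| = √(1 + z ⬝ᵥ z) ∧
      ∀ (k : ℕ) (M : Matrix (Fin m) (Fin k) ℝ),
        ∑ i, (R * M) i ⬝ᵥ (R * M) i = ∑ i, M i ⬝ᵥ M i + (z ᵥ* M) ⬝ᵥ (z ᵥ* M) := by
  have hz : 0 ≤ z ⬝ᵥ z := Finset.sum_nonneg fun i _ => mul_self_nonneg _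
  obtain ⟨β, hβ⟩ : ∃ β : ℝ, 2 * β + β ^ 2 * (z ⬝ᵥ z) = 1 := by
    refine ⟨1 / (1 + √(1 + z ⬝ᵥ z)), ?_⟩
    have h := Real.sq_sqrt (show 0 ≤ 1 + z ⬝ᵥ z by linarith)
    have h0 := Real.sqrt_nonneg (1 + z ⬝ᵥ z)
    field_simp
    nlinarith
  have hdet : (1 + β • Matrix.vecMulVec z z : Matrix (Fin m) (Fin m) ℝ).det = 1 + β * (z ⬝ᵥ z) := by
    have := Matrix.det_one_add_replicateCol_mul_replicateRow (ι := Unit) (β • z) z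
    rw [dotProduct_smul, smul_eq_mul] at this
    rw [← this, ← Matrix.vecMulVec_eq Unit, Matrix.smul_vecMulVec]
  refine ⟨1 + β • Matrix.vecMulVec z z, ?_, fun k M => ?_⟩
  · rw [hdet, ← Real.sqrt_sq_eq_abs]
    congr 1
    linear_combination (z ⬝ᵥ z) * hβ
  · have hRR : (1 + β • Matrix.vecMulVec z z : Matrix (Fin m) (Fin m) ℝ)ᵀ *
        (1 + β • Matrix.vecMulVec z z) = 1 + Matrix.vecMulVec z z := by
      have h1 : (Matrix.vecMulVec z z)ᵀ = Matrix.vecMulVec z z := by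
        rw [Matrix.transpose_vecMulVec]
      have h2 : Matrix.vecMulVec z z * Matrix.vecMulVec z z = (z ⬝ᵥ z) • Matrix.vecMulVec z z := by
        rw [Matrix.vecMulVec_mul_vecMulVec]
        ext i j
        simp [Matrix.vecMulVec_apply]; ring
      rw [Matrix.transpose_add, Matrix.transpose_smul, h1, Matrix.transpose_one]
      simp only [add_mul, mul_add, one_mul, mul_one, Matrix.smul_mul, Matrix.mul_smul, h2,
        smul_smul]
      rw [add_assoc, ← add_smul, ← add_smul]
      rw [show β + (β + β * (β * (z ⬝ᵥ z))) = 1 by linear_combination hβ, one_smul]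
    rw [sum_dotProduct_rows, sum_dotProduct_rows, Matrix.transpose_mul, Matrix.mul_assoc,
      ← Matrix.mul_assoc _ _ M, hRR, Matrix.add_mul, Matrix.one_mul, Matrix.mul_add,
      Matrix.trace_add]
    congr 1
    rw [Matrix.vecMulVec_mul, Matrix.mul_vecMulVec, Matrix.trace_vecMulVec, Matrix.mulVec_transpose]

theorem stdGaussianMatrixPDF_mul_vecMul {m k : ℕ} {z : Fin m → ℝ} {R : Matrix (Fin m) (Fin m) ℝ}
    (hR : ∀ (k : ℕ) (M : Matrix (Fin m) (Fin k) ℝ),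
        ∑ i, (R * M) i ⬝ᵥ (R * M) i = ∑ i, M i ⬝ᵥ M i + (z ᵥ* M) ⬝ᵥ (z ᵥ* M))
    (M : Matrix (Fin m) (Fin k) ℝ) :
    stdGaussianMatrixPDF M * stdGaussianPDF (z ᵥ* M) =
      ENNReal.ofReal ((√(2 * π))⁻¹ ^ k) * stdGaussianMatrixPDF (R * M) := by
  rw [stdGaussianMatrixPDF_eq, stdGaussianMatrixPDF_eq, stdGaussianPDF_eq,
    ← ENNReal.ofReal_mul (by positivity), ← ENNReal.ofReal_mul (by positivity), hR]
  congr 1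
  rw [neg_add, add_div, Real.exp_add]
  ring

/-- The expected absolute value of the determinant of a standard Gaussian matrix. -/
noncomputable def meanAbsDet (k : ℕ) : ℝ≥0∞ :=
  ∫⁻ M : Fin k → Fin k → ℝ, ENNReal.ofReal |(Matrix.of M).det| * stdGaussianMatrixPDF (Matrix.of M)

theorem lintegral_absDet_mul_stdGaussianMatrixPDF {k : ℕ} {R : Matrix (Fin k) (Fin k) ℝ}
    (hR : R.det ≠ 0) :
    ∫⁻ M : Fin k → Fin k → ℝ,
        ENNReal.ofReal |(Matrix.of M).det| * stdGaussianMatrixPDF (R * Matrix.of M) =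
      ENNReal.ofReal ((|R.det| ^ (k + 1))⁻¹) * meanAbsDet k := by
  have h := lintegral_rows_mul (k := k) hR fun M =>
    ENNReal.ofReal |(Matrix.of M).det| * stdGaussianMatrixPDF (Matrix.of M)
  have h0 : 0 < |R.det| := abs_pos.2 hR
  calc _ = ∫⁻ M : Fin k → Fin k → ℝ, ENNReal.ofReal |R.det|⁻¹ *
        (ENNReal.ofReal |(R * Matrix.of M).det| * stdGaussianMatrixPDF (R * Matrix.of M)) := by
        refine lintegral_congr fun M => ?_
        rw [← mul_assoc, ← ENNReal.ofReal_mul (by positivity), Matrix.det_mul, abs_mul,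
          inv_mul_cancel_left₀ h0.ne']
    _ = _ := by
        rw [lintegral_const_mul' _ _ ENNReal.ofReal_ne_top]
        erw [h]
        rw [← mul_assoc, ← ENNReal.ofReal_mul (by positivity), meanAbsDet]
        congr 2
        rw [abs_inv, abs_pow, pow_succ', mul_inv]

theorem gaussian_complete_square {n : ℕ} (w β C : Fin n → ℝ) (y t : ℝ) {B : Fin n → ℝ}
    (hB : B = β + (y / (1 + w ⬝ᵥ w)) • w + (t / (1 + t ^ 2)) • C) :
    (y - w ⬝ᵥ B) ^ 2 + B ⬝ᵥ B + (t • B - C) ⬝ᵥ (t • B - C) + (t * (y - w ⬝ᵥ B) + w ⬝ᵥ C) ^ 2 =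
      (1 + t ^ 2) * (β ⬝ᵥ β + (w ⬝ᵥ β) ^ 2) + (1 + t ^ 2) / (1 + w ⬝ᵥ w) * y ^ 2 +
        1 / (1 + t ^ 2) * (C ⬝ᵥ C + (w ⬝ᵥ C) ^ 2) := by
  have hw : 0 ≤ w ⬝ᵥ w := Finset.sum_nonneg fun i _ => mul_self_nonneg _
  have hV : 1 + w ⬝ᵥ w ≠ 0 := by positivity
  have hT : 1 + t ^ 2 ≠ 0 := by positivity
  subst hB
  simp only [dotProduct_add, add_dotProduct, dotProduct_sub, sub_dotProduct, dotProduct_smul,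
    smul_dotProduct, smul_eq_mul, dotProduct_comm β w, dotProduct_comm C w, dotProduct_comm C β]
  generalize w ⬝ᵥ w = s at *
  generalize w ⬝ᵥ β = p
  generalize w ⬝ᵥ C = q
  generalize β ⬝ᵥ C = r
  generalize β ⬝ᵥ β = bb
  generalize C ⬝ᵥ C = cc
  field_simp
  ring

theorem sum_dotProduct_rows_eq_sum_cols {m k : ℕ} (M : Matrix (Fin m) (Fin k) ℝ) :
    ∑ i, M i ⬝ᵥ M i = ∑ l, M.col l ⬝ᵥ M.col l :=
  Finset.sum_comm

/-- The matrix with first row `y` followed by the rows of `C`. -/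
def consRow {n k : ℕ} (y : Fin k → ℝ) (C : Matrix (Fin n) (Fin k) ℝ) :
    Matrix (Fin (n + 1)) (Fin k) ℝ :=
  Matrix.of (Fin.cons (α := fun _ => Fin k → ℝ) y C)

theorem consRow_zero {n k : ℕ} (y : Fin k → ℝ) (C : Matrix (Fin n) (Fin k) ℝ) :
    consRow y C 0 = y := rfl

theorem consRow_succ {n k : ℕ} (y : Fin k → ℝ) (C : Matrix (Fin n) (Fin k) ℝ) (i : Fin n) :
    consRow y C i.succ = C i := rfl

/-- The block diagonal matrix `diag(a, R)`. -/
def consDiag {n : ℕ} (a : ℝ) (R : Matrix (Fin n) (Fin n) ℝ) :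
    Matrix (Fin (n + 1)) (Fin (n + 1)) ℝ :=
  consRow (Fin.cons a 0) (Matrix.of fun i => (Fin.cons 0 (R i) : Fin (n + 1) → ℝ))

theorem consDiag_mul_consRow {n k : ℕ} (a : ℝ) (R : Matrix (Fin n) (Fin n) ℝ) (y : Fin k → ℝ)
    (C : Matrix (Fin n) (Fin k) ℝ) :
    consDiag a R * consRow y C = consRow (a • y) (R * C) := by
  ext i l
  refine Fin.cases ?_ (fun i => ?_) i
  · simp [consDiag, Matrix.mul_apply, Fin.sum_univ_succ, consRow_zero, consRow_succ]
  · simp [consDiag, Matrix.mul_apply, Fin.sum_univ_succ, consRow_zero, consRow_succ]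

theorem det_consDiag {n : ℕ} (a : ℝ) (R : Matrix (Fin n) (Fin n) ℝ) :
    (consDiag a R).det = a * R.det := by
  rw [Matrix.det_succ_row_zero, Fin.sum_univ_succ]
  have : (consDiag a R).submatrix Fin.succ (Fin.succAbove 0) = R := by
    ext i j
    simp [consDiag, consRow_succ]
  rw [this]
  simp [consDiag, consRow_zero]

theorem stdGaussianMatrixPDF_consRow {n k : ℕ} (y : Fin k → ℝ) (C : Matrix (Fin n) (Fin k) ℝ) :
    stdGaussianMatrixPDF (consRow y C) = stdGaussianPDF y * stdGaussianMatrixPDF C := by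
  rw [stdGaussianMatrixPDF, Fin.prod_univ_succ]
  rfl

theorem gaussian_complete_square_rows {n k : ℕ} (w : Fin n → ℝ) (β C : Matrix (Fin n) (Fin k) ℝ)
    (y : Fin k → ℝ) (t : ℝ) {B : Matrix (Fin n) (Fin k) ℝ}
    (hB : B = β + Matrix.vecMulVec ((1 + w ⬝ᵥ w)⁻¹ • w) y + (t / (1 + t ^ 2)) • C) :
    (y - w ᵥ* B) ⬝ᵥ (y - w ᵥ* B) + ∑ i, B i ⬝ᵥ B i + ∑ i, (t • B - C) i ⬝ᵥ (t • B - C) i +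
        (t • (y - w ᵥ* B) + w ᵥ* C) ⬝ᵥ (t • (y - w ᵥ* B) + w ᵥ* C) =
      (1 + t ^ 2) * (∑ i, β i ⬝ᵥ β i + (w ᵥ* β) ⬝ᵥ (w ᵥ* β)) +
        ((1 + t ^ 2) / (1 + w ⬝ᵥ w) * (y ⬝ᵥ y) +
        1 / (1 + t ^ 2) * (∑ i, C i ⬝ᵥ C i + (w ᵥ* C) ⬝ᵥ (w ᵥ* C))) := by
  have hcol : ∀ l, B.col l = β.col l + (y l / (1 + w ⬝ᵥ w)) • w + (t / (1 + t ^ 2)) • C.col l := by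
    intro l
    ext i
    simp [hB, Matrix.vecMulVec_apply]
    ring
  have key := fun l => gaussian_complete_square w (β.col l) (C.col l) (y l) t (hcol l)
  have := Finset.sum_congr (rfl : (Finset.univ : Finset (Fin k)) = Finset.univ) fun l _ => key l
  simp only [Finset.sum_add_distrib, ← Finset.mul_sum] at this
  simp only [sum_dotProduct_rows_eq_sum_cols]
  have e1 : ∀ v : Fin k → ℝ, v ⬝ᵥ v = ∑ l, v l ^ 2 := fun v => by simp [dotProduct, sq]
  rw [e1 (y - w ᵥ* B), e1 (t • (y - w ᵥ* B) + w ᵥ* C), e1 (w ᵥ* β), e1 y, e1 (w ᵥ* C)]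
  rw [← add_assoc]
  exact this

theorem gaussian_density_complete_square {n k : ℕ} {w : Fin n → ℝ} {R : Matrix (Fin n) (Fin n) ℝ}
    (hR : ∀ (k : ℕ) (M : Matrix (Fin n) (Fin k) ℝ),
        ∑ i, (R * M) i ⬝ᵥ (R * M) i = ∑ i, M i ⬝ᵥ M i + (w ᵥ* M) ⬝ᵥ (w ᵥ* M))
    (β C : Matrix (Fin n) (Fin k) ℝ) (y : Fin k → ℝ) (t : ℝ) {B : Matrix (Fin n) (Fin k) ℝ}
    (hB : B = β + Matrix.vecMulVec ((1 + w ⬝ᵥ w)⁻¹ • w) y + (t / (1 + t ^ 2)) • C) :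
    stdGaussianPDF (y - w ᵥ* B) * stdGaussianMatrixPDF B * stdGaussianMatrixPDF (t • B - C) *
        stdGaussianPDF (t • (y - w ᵥ* B) + w ᵥ* C) =
      ENNReal.ofReal ((√(2 * π))⁻¹ ^ k) * stdGaussianMatrixPDF ((√(1 + t ^ 2) • R) * β) *
        stdGaussianMatrixPDF (consDiag √((1 + t ^ 2) / (1 + w ⬝ᵥ w)) ((√(1 + t ^ 2))⁻¹ • R) *
          consRow y C) := by
  have hw : 0 ≤ w ⬝ᵥ w := Finset.sum_nonneg fun i _ => mul_self_nonneg _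
  rw [consDiag_mul_consRow, stdGaussianMatrixPDF_consRow]
  simp only [stdGaussianMatrixPDF_eq, stdGaussianPDF_eq]
  simp only [← ENNReal.ofReal_mul (show 0 ≤ (√(2 * π))⁻¹ ^ k by positivity)]
  repeat rw [← ENNReal.ofReal_mul (by positivity)]
  congr 1
  have h1 : ∀ (a : ℝ) (M : Matrix (Fin n) (Fin k) ℝ),
      ∑ i, (a • M) i ⬝ᵥ (a • M) i = a ^ 2 * ∑ i, M i ⬝ᵥ M i := by
    intro a M
    rw [Finset.mul_sum]
    refine Finset.sum_congr rfl fun i _ => ?_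
    change (a • M i) ⬝ᵥ (a • M i) = _
    rw [smul_dotProduct, dotProduct_smul, smul_eq_mul, smul_eq_mul]
    ring
  have hsq := gaussian_complete_square_rows w β C y t hB
  rw [Matrix.smul_mul, Matrix.smul_mul, h1, h1, hR, hR, smul_dotProduct, dotProduct_smul,
    smul_eq_mul, smul_eq_mul, Real.sq_sqrt (by positivity), ← mul_assoc (√_) (√_), Real.mul_self_sqrt (by positivity)]
  have h2 : ∀ p q a b c d : ℝ, p * rexp a * (q * rexp b) * (q * rexp c) * (p * rexp d) =
      p * q * (p * q) * rexp (a + b + c + d) := by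
    intros
    simp only [Real.exp_add]
    ring
  have h3 : ∀ p q a b c : ℝ, p * (q * rexp a) * (p * rexp b * (q * rexp c)) =
      p * q * (p * q) * rexp (a + b + c) := by
    intros
    simp only [Real.exp_add]
    ring
  rw [h2, h3]
  congr 2
  have h4 : (√(1 + t ^ 2))⁻¹ ^ 2 = 1 / (1 + t ^ 2) := by
    rw [inv_pow, Real.sq_sqrt (by positivity), one_div]
  rw [h4]
  linear_combination (-1 / 2) * hsq

theorem lintegral_consRow {n k : ℕ} (G : Matrix (Fin (n + 1)) (Fin k) ℝ → ℝ≥0∞) :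
    ∫⁻ p : (Fin k → ℝ) × (Fin n → Fin k → ℝ), G (consRow p.1 (Matrix.of p.2)) =
      ∫⁻ M : Fin (n + 1) → Fin k → ℝ, G (Matrix.of M) := by
  rw [← (volume_preserving_piFinSuccAbove (fun _ : Fin (n + 1) => Fin k → ℝ)
    0).symm.lintegral_comp_emb (MeasurableEquiv.measurableEmbedding _)]
  refine lintegral_congr fun p => congrArg G ?_
  ext i j
  refine Fin.cases ?_ (fun i => ?_) i
  · simp [consRow_zero, MeasurableEquiv.piFinSuccAbove]
  · simp [consRow_succ, MeasurableEquiv.piFinSuccAbove]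

theorem continuous_consRow {X : Type*} [TopologicalSpace X] {n k : ℕ} {y : X → Fin k → ℝ}
    {C : X → Matrix (Fin n) (Fin k) ℝ} (hy : Continuous y) (hC : Continuous C) :
    Continuous fun x => consRow (y x) (C x) := by
  refine continuous_pi fun i => ?_
  refine Fin.cases ?_ (fun i => ?_) i
  · exact hy
  · exact (continuous_apply i).comp hC

theorem lintegral_add_shift {n k : ℕ} {R : Matrix (Fin n) (Fin n) ℝ} (hR : R.det ≠ 0)
    (S : Matrix (Fin n) (Fin k) ℝ) :
    ∫⁻ B : Fin n → Fin k → ℝ, stdGaussianMatrixPDF (R * (Matrix.of B - S)) =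
      ENNReal.ofReal ((|R.det| ^ k)⁻¹) := by
  have h1 := lintegral_sub_right_eq_self (μ := (volume : Measure (Fin n → Fin k → ℝ)))
    (fun B => stdGaussianMatrixPDF (R * Matrix.of B)) S
  have h2 := lintegral_rows_mul (k := k) hR fun M => stdGaussianMatrixPDF (Matrix.of M)
  rw [lintegral_stdGaussianMatrixPDF, mul_one, abs_inv, abs_pow] at h2
  exact h1.trans h2

theorem measurable_stdGaussianMatrixPDF_comp {X : Type*} [TopologicalSpace X] [MeasurableSpace X]
    [OpensMeasurableSpace X] {n k : ℕ} {M : X → Matrix (Fin n) (Fin k) ℝ} (hM : Continuous M) :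
    Measurable fun x => stdGaussianMatrixPDF (M x) :=
  by
  have h : Continuous (Y := Fin n → Fin k → ℝ) M := hM
  exact measurable_stdGaussianMatrixPDF.comp h.measurable

theorem measurable_stdGaussianPDF_comp {X : Type*} [TopologicalSpace X] [MeasurableSpace X]
    [OpensMeasurableSpace X] {k : ℕ} {y : X → Fin k → ℝ} (hy : Continuous y) :
    Measurable fun x => stdGaussianPDF (y x) :=
  measurable_stdGaussianPDF.comp hy.measurable

/-- Integrating out both matrices below the first row: up to a constant, the density of `(t, w)`
is the product of the Cauchy density and the density of a multivariate Cauchy vector. -/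
theorem lintegral_kernel {n : ℕ} (t : ℝ) (w : Fin n → ℝ) :
    ∫⁻ B : Fin n → Fin (n + 1) → ℝ, ∫⁻ b : Fin (n + 1) → ℝ, ∫⁻ A : Fin n → Fin (n + 1) → ℝ,
      stdGaussianPDF b * stdGaussianMatrixPDF (Matrix.of B) * stdGaussianMatrixPDF (Matrix.of A) *
        (ENNReal.ofReal |(consRow (b + w ᵥ* Matrix.of B) (t • Matrix.of B - Matrix.of A)).det| *
          stdGaussianPDF (t • (b + w ᵥ* Matrix.of B) - w ᵥ* Matrix.of A)) =
      ENNReal.ofReal ((√(2 * π))⁻¹ ^ (n + 1)) * meanAbsDet (n + 1) *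
        ENNReal.ofReal (((1 + t ^ 2) * √(1 + w ⬝ᵥ w) ^ (n + 1))⁻¹) := by
  obtain ⟨R, hRdet, hR⟩ := exists_sqrt_one_add_vecMulVec w
  have hw : 0 ≤ w ⬝ᵥ w := Finset.sum_nonneg fun i _ => mul_self_nonneg _
  have hV : 0 < √(1 + w ⬝ᵥ w) := Real.sqrt_pos.2 (by positivity)
  have hT : 0 < √(1 + t ^ 2) := Real.sqrt_pos.2 (by positivity)
  have hR0 : R.det ≠ 0 := abs_pos.1 (hRdet ▸ hV)
  have hR1 : (√(1 + t ^ 2) • R).det ≠ 0 := by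
    rw [Matrix.det_smul]; positivity
  have hR2 : (consDiag √((1 + t ^ 2) / (1 + w ⬝ᵥ w)) ((√(1 + t ^ 2))⁻¹ • R)).det ≠ 0 := by
    rw [det_consDiag, Matrix.det_smul]; positivity
  have step1 : ∀ B : Fin n → Fin (n + 1) → ℝ,
      (∫⁻ b : Fin (n + 1) → ℝ, ∫⁻ A : Fin n → Fin (n + 1) → ℝ,
      stdGaussianPDF b * stdGaussianMatrixPDF (Matrix.of B) * stdGaussianMatrixPDF (Matrix.of A) *
        (ENNReal.ofReal |(consRow (b + w ᵥ* Matrix.of B) (t • Matrix.of B - Matrix.of A)).det| *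
          stdGaussianPDF (t • (b + w ᵥ* Matrix.of B) - w ᵥ* Matrix.of A))) =
      ∫⁻ p : (Fin (n + 1) → ℝ) × (Fin n → Fin (n + 1) → ℝ),
        ENNReal.ofReal ((√(2 * π))⁻¹ ^ (n + 1)) * stdGaussianMatrixPDF ((√(1 + t ^ 2) • R) *
          (Matrix.of B - (Matrix.vecMulVec ((1 + w ⬝ᵥ w)⁻¹ • w) p.1 +
            (t / (1 + t ^ 2)) • Matrix.of p.2))) *
        (ENNReal.ofReal |(consRow p.1 (Matrix.of p.2)).det| *
        stdGaussianMatrixPDF (consDiag √((1 + t ^ 2) / (1 + w ⬝ᵥ w)) ((√(1 + t ^ 2))⁻¹ • R) *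
          consRow p.1 (Matrix.of p.2))) := by
    intro B
    have hmeas : Measurable fun p : (Fin (n + 1) → ℝ) × (Fin n → Fin (n + 1) → ℝ) =>
        stdGaussianPDF (p.1 - w ᵥ* Matrix.of B) * stdGaussianMatrixPDF (Matrix.of B) *
          stdGaussianMatrixPDF (t • Matrix.of B - Matrix.of p.2) *
        (ENNReal.ofReal |(consRow p.1 (Matrix.of p.2)).det| *
          stdGaussianPDF (t • (p.1 - w ᵥ* Matrix.of B) + w ᵥ* Matrix.of p.2)) := by
      refine ((Measurable.mul ?_ measurable_const).mul ?_).mul (Measurable.mul ?_ ?_)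
      · exact measurable_stdGaussianPDF_comp (by fun_prop)
      · exact measurable_stdGaussianMatrixPDF_comp (by fun_prop)
      · exact (Continuous.abs (Continuous.matrix_det
          (continuous_consRow (by fun_prop) (by fun_prop)))).measurable.ennreal_ofReal
      · exact measurable_stdGaussianPDF_comp (by fun_prop)
    rw [← lintegral_sub_right_eq_self _ (w ᵥ* Matrix.of B)]
    calc _ = ∫⁻ b : Fin (n + 1) → ℝ, ∫⁻ A : Fin n → Fin (n + 1) → ℝ,
        stdGaussianPDF (b - w ᵥ* Matrix.of B) * stdGaussianMatrixPDF (Matrix.of B) *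
          stdGaussianMatrixPDF (t • Matrix.of B - Matrix.of A) *
        (ENNReal.ofReal |(consRow b (Matrix.of A)).det| *
          stdGaussianPDF (t • (b - w ᵥ* Matrix.of B) + w ᵥ* Matrix.of A)) := by
          refine lintegral_congr fun b => ?_
          rw [← lintegral_sub_left_eq_self _ (t • B)]
          refine lintegral_congr fun A => ?_
          have e1 : Matrix.of (t • B - A) = t • Matrix.of B - Matrix.of A := rfl
          have e2 : t • Matrix.of B - (t • Matrix.of B - Matrix.of A) = Matrix.of A :=
            sub_sub_cancel _ _
          have e3 : t • b - w ᵥ* (t • Matrix.of B - Matrix.of A) =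
              t • (b - w ᵥ* Matrix.of B) + w ᵥ* Matrix.of A := by
            rw [Matrix.vecMul_sub, Matrix.vecMul_smul, smul_sub]
            abel
          rw [e1, e2, sub_add_cancel, e3]
      _ = _ := by
          rw [← lintegral_prod _ hmeas.aemeasurable]
          refine lintegral_congr fun p => ?_
          have := gaussian_density_complete_square hR
            (Matrix.of B - (Matrix.vecMulVec ((1 + w ⬝ᵥ w)⁻¹ • w) p.1 +
            (t / (1 + t ^ 2)) • Matrix.of p.2)) (Matrix.of p.2) p.1 t (B := Matrix.of B)
            (by abel)
          rw [mul_left_comm, this]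
          ring
  simp_rw [step1]
  rw [lintegral_lintegral_swap]
  · have h1 : ∀ p : (Fin (n + 1) → ℝ) × (Fin n → Fin (n + 1) → ℝ),
        (∫⁻ B : Fin n → Fin (n + 1) → ℝ,
        ENNReal.ofReal ((√(2 * π))⁻¹ ^ (n + 1)) * stdGaussianMatrixPDF ((√(1 + t ^ 2) • R) *
          (Matrix.of B - (Matrix.vecMulVec ((1 + w ⬝ᵥ w)⁻¹ • w) p.1 +
            (t / (1 + t ^ 2)) • Matrix.of p.2))) *
        (ENNReal.ofReal |(consRow p.1 (Matrix.of p.2)).det| *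
        stdGaussianMatrixPDF (consDiag √((1 + t ^ 2) / (1 + w ⬝ᵥ w)) ((√(1 + t ^ 2))⁻¹ • R) *
          consRow p.1 (Matrix.of p.2)))) =
        ENNReal.ofReal ((√(2 * π))⁻¹ ^ (n + 1)) *
          ENNReal.ofReal ((|(√(1 + t ^ 2) • R).det| ^ (n + 1))⁻¹) *
        (ENNReal.ofReal |(consRow p.1 (Matrix.of p.2)).det| *
        stdGaussianMatrixPDF (consDiag √((1 + t ^ 2) / (1 + w ⬝ᵥ w)) ((√(1 + t ^ 2))⁻¹ • R) *
          consRow p.1 (Matrix.of p.2))) := by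
      intro p
      have hm : ∀ S : Matrix (Fin n) (Fin (n + 1)) ℝ, Measurable fun B : Fin n → Fin (n + 1) → ℝ =>
          stdGaussianMatrixPDF ((√(1 + t ^ 2) • R) * (Matrix.of B - S)) := fun S =>
        measurable_stdGaussianMatrixPDF_comp (by fun_prop)
      rw [lintegral_mul_const _ ((hm _).const_mul _), lintegral_const_mul _ (hm _),
        lintegral_add_shift hR1]
    simp_rw [h1]
    rw [lintegral_const_mul' _ _ (ENNReal.mul_ne_top ENNReal.ofReal_ne_top ENNReal.ofReal_ne_top)]
    erw [lintegral_consRow (fun M => ENNReal.ofReal |M.det| * stdGaussianMatrixPDF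
      (consDiag √((1 + t ^ 2) / (1 + w ⬝ᵥ w)) ((√(1 + t ^ 2))⁻¹ • R) * M))]
    rw [lintegral_absDet_mul_stdGaussianMatrixPDF hR2, mul_assoc, ← mul_assoc (ENNReal.ofReal _⁻¹),
      ← ENNReal.ofReal_mul (by positivity), mul_comm _ (meanAbsDet _), mul_assoc]
    congr 3
    rw [det_consDiag, Matrix.det_smul, Matrix.det_smul, Fintype.card_fin, abs_mul, abs_mul, abs_mul,
      hRdet, abs_of_nonneg (by positivity : 0 ≤ √(1 + t ^ 2) ^ n),
      abs_of_nonneg (by positivity : 0 ≤ (√(1 + t ^ 2))⁻¹ ^ n),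
      abs_of_nonneg (Real.sqrt_nonneg _), Real.sqrt_div (by positivity)]
    rw [← mul_inv, ← Real.sq_sqrt (by positivity : 0 ≤ 1 + t ^ 2), Real.sqrt_sq hT.le]
    generalize √(1 + t ^ 2) = τ at hT
    generalize √(1 + w ⬝ᵥ w) = v at hV
    congr 1
    have hp : 0 < τ ^ n := by positivity
    have h2 : τ / v * (τ⁻¹ ^ n * v) = τ * (τ ^ n)⁻¹ := by
      rw [inv_pow]; field_simp
    have h3 : τ ^ (n + 2) = τ ^ n * τ ^ 2 := pow_add _ _ _
    rw [h2, mul_pow, mul_pow τ, show n + 1 + 1 = n + 2 from rfl, h3]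
    generalize τ ^ n = p at hp
    rw [inv_pow, pow_succ p (n + 1)]
    field_simp
  · refine Measurable.aemeasurable ?_
    refine Measurable.mul (measurable_const.mul ?_) (Measurable.mul ?_ ?_)
    · exact measurable_stdGaussianMatrixPDF_comp (by fun_prop)
    · exact (Continuous.abs (Continuous.matrix_det
          (continuous_consRow (by fun_prop) (by fun_prop)))).measurable.ennreal_ofReal
    · exact measurable_stdGaussianMatrixPDF_comp (Continuous.matrix_mul (by fun_prop)
        (continuous_consRow (by fun_prop) (by fun_prop)))

theorem lintegral_inv_one_add_sq : ∫⁻ t : ℝ, ENNReal.ofReal (1 + t ^ 2)⁻¹ = ENNReal.ofReal π := by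
  rw [← ofReal_integral_eq_lintegral_ofReal integrable_inv_one_add_sq
    (ae_of_all _ fun t => by positivity), integral_univ_inv_one_add_sq]

theorem lintegral_exp_neg_mul_dotProduct {m : ℕ} {r : ℝ} (hr : 0 < r) :
    ∫⁻ z : Fin m → ℝ, ENNReal.ofReal (rexp (-(r * (z ⬝ᵥ z)))) =
      ENNReal.ofReal (√(π / r) ^ m) := by
  have h1 : ∫⁻ x : ℝ, ENNReal.ofReal (rexp (-r * x ^ 2)) = ENNReal.ofReal √(π / r) := by
    rw [← ofReal_integral_eq_lintegral_ofReal (integrable_exp_neg_mul_sq hr)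
      (ae_of_all _ fun t => by positivity), integral_gaussian]
  have h2 := lintegral_pi_fin_prod (volume : Measure ℝ) (n := m)
    (f := fun _ x => ENNReal.ofReal (rexp (-r * x ^ 2))) fun _ => by fun_prop
  rw [h1, Finset.prod_const, Finset.card_univ, Fintype.card_fin,
    ← ENNReal.ofReal_pow (by positivity)] at h2
  rw [← h2]
  refine lintegral_congr fun z => ?_
  rw [← ENNReal.ofReal_prod_of_nonneg fun i _ => by positivity, ← Real.exp_sum, ← Finset.mul_sum]
  simp [dotProduct, sq]

theorem lintegral_rpow_mul_exp {a r : ℝ} (ha : 0 < a) (hr : 0 < r) :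
    ∫⁻ t in Set.Ioi 0, ENNReal.ofReal (t ^ (a - 1) * rexp (-(r * t))) =
      ENNReal.ofReal ((1 / r) ^ a * Gamma a) := by
  have h := integral_rpow_mul_exp_neg_mul_Ioi ha hr
  have hG := Gamma_pos_of_pos ha
  have hi : Integrable (fun t : ℝ => t ^ (a - 1) * rexp (-(r * t))) (volume.restrict (Set.Ioi 0)) :=
    Integrable.of_integral_ne_zero (by rw [h]; positivity)
  rw [← h, ofReal_integral_eq_lintegral_ofReal hi]
  filter_upwards [ae_restrict_mem measurableSet_Ioi] with t (ht : 0 < t)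
  simp only [Pi.zero_apply]
  positivity

theorem lintegral_inv_sqrt_one_add_pow (m : ℕ) :
    ∫⁻ z : Fin m → ℝ, ENNReal.ofReal ((√(1 + z ⬝ᵥ z) ^ (m + 1))⁻¹) =
      ENNReal.ofReal (√π ^ (m + 1) / Gamma (((m : ℝ) + 1) / 2)) := by
  have hs : 0 < ((m : ℝ) + 1) / 2 := by positivity
  have hG := Gamma_pos_of_pos hs
  set s := ((m : ℝ) + 1) / 2 with hsdef
  have h1 : ∀ z : Fin m → ℝ, ENNReal.ofReal (Gamma s) *
        ENNReal.ofReal ((√(1 + z ⬝ᵥ z) ^ (m + 1))⁻¹) =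
      ∫⁻ t in Set.Ioi 0, ENNReal.ofReal (t ^ (s - 1) * rexp (-t)) *
        ENNReal.ofReal (rexp (-(t * (z ⬝ᵥ z)))) := by
    intro z
    have hz : 0 ≤ z ⬝ᵥ z := Finset.sum_nonneg fun i _ => mul_self_nonneg _
    have hV : 0 < 1 + z ⬝ᵥ z := by positivity
    have e1 : (√(1 + z ⬝ᵥ z) ^ (m + 1))⁻¹ = (1 / (1 + z ⬝ᵥ z)) ^ s := by
      rw [one_div, Real.inv_rpow hV.le, Real.sqrt_eq_rpow, ← Real.rpow_natCast,
        ← Real.rpow_mul hV.le]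
      congr 2
      push_cast
      rw [hsdef]; ring
    rw [e1, ← ENNReal.ofReal_mul hG.le, mul_comm, ← lintegral_rpow_mul_exp hs hV]
    refine lintegral_congr fun t => ?_
    rw [← ENNReal.ofReal_mul' (by positivity), mul_assoc, ← Real.exp_add]
    congr 3
    ring_nf
  have h2 : ENNReal.ofReal (Gamma s) *
      ∫⁻ z : Fin m → ℝ, ENNReal.ofReal ((√(1 + z ⬝ᵥ z) ^ (m + 1))⁻¹) =
      ENNReal.ofReal (√π ^ (m + 1)) := by
    rw [← lintegral_const_mul' _ _ ENNReal.ofReal_ne_top]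
    simp_rw [h1]
    rw [lintegral_lintegral_swap]
    · calc _ = ∫⁻ t in Set.Ioi (0 : ℝ), ENNReal.ofReal (√π ^ m) *
            ENNReal.ofReal (t ^ ((1 / 2 : ℝ) - 1) * rexp (-(1 * t))) := by
            refine setLIntegral_congr_fun measurableSet_Ioi fun t (ht : 0 < t) => ?_
            rw [lintegral_const_mul' _ _ ENNReal.ofReal_ne_top,
              lintegral_exp_neg_mul_dotProduct ht, ← ENNReal.ofReal_mul (by positivity),
              ← ENNReal.ofReal_mul (by positivity)]
            congr 1
            have e2 : t ^ (s - 1) = t ^ ((1 / 2 : ℝ) - 1) * √t ^ m := by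
              rw [Real.sqrt_eq_rpow, ← Real.rpow_natCast, ← Real.rpow_mul ht.le, ← Real.rpow_add ht]
              congr 1
              rw [hsdef]; ring
            rw [e2, Real.sqrt_div Real.pi_pos.le, one_mul, div_pow]
            have : 0 < √t := Real.sqrt_pos.2 ht
            field_simp
        _ = _ := by
            rw [lintegral_const_mul' _ _ ENNReal.ofReal_ne_top,
              lintegral_rpow_mul_exp (by norm_num) one_pos, ← ENNReal.ofReal_mul (by positivity),
              Real.Gamma_one_half_eq]
            simp [pow_succ]
    · refine Measurable.aemeasurable ?_
      simp only [Function.uncurry_def, dotProduct]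
      fun_prop
  rw [ENNReal.ofReal_div_of_pos hG, ← h2, mul_comm, ENNReal.mul_div_cancel_right]
  · simpa using hG
  · exact ENNReal.ofReal_ne_top

theorem lintegral_eigen_density (n : ℕ) :
    ∫⁻ u : Fin (n + 1) → ℝ, ENNReal.ofReal
      (((1 + u 0 ^ 2) * √(1 + (fun i : Fin n => u i.succ) ⬝ᵥ
        fun i : Fin n => u i.succ) ^ (n + 1))⁻¹) =
      ENNReal.ofReal (π * (√π ^ (n + 1) / Gamma (((n : ℝ) + 1) / 2))) := by
  rw [ENNReal.ofReal_mul Real.pi_pos.le, ← lintegral_inv_sqrt_one_add_pow,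
    ← lintegral_inv_one_add_sq, ← lintegral_prod_mul (by fun_prop)
      (by simp only [dotProduct]; fun_prop),
    ← (volume_preserving_piFinSuccAbove (fun _ : Fin (n + 1) => ℝ)
    0).symm.lintegral_comp_emb (MeasurableEquiv.measurableEmbedding _)]
  refine lintegral_congr fun p => ?_
  rw [← ENNReal.ofReal_mul (by positivity), mul_inv]
  simp [MeasurableEquiv.piFinSuccAbove]

theorem volume_image_null {Q E : Type*} [TopologicalSpace Q] [SecondCountableTopology Q]
    [MeasurableSpace Q] [BorelSpace Q] [NormedAddCommGroup E] [NormedSpace ℝ E]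
    [FiniteDimensional ℝ E] [MeasurableSpace E] [BorelSpace E] (ρ : Measure Q) [SFinite ρ]
    (ν : Measure E) [ν.IsAddHaarMeasure] {F : Q × E → E} (hF : Continuous F)
    (hd : ∀ q, Differentiable ℝ fun u => F (q, u)) {S : Set E} (hS : IsClosed S) (h0 : ν S = 0) :
    ∀ᵐ p ∂ρ.prod ν, ∀ u ∈ S, p.2 ≠ F (p.1, u) := by
  have : ProperSpace E := FiniteDimensional.proper ℝ E
  have : SecondCountableTopology E := inferInstance
  have hset : {p : Q × E | ¬ ∀ u ∈ S, p.2 ≠ F (p.1, u)} =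
      ⋃ k : ℕ, {p : Q × E | ∃ u ∈ S ∩ Metric.closedBall 0 k, p.2 - F (p.1, u) = 0} := by
    ext p
    simp only [Set.mem_ofPred_eq, Set.mem_iUnion, not_forall, not_not, sub_eq_zero]
    constructor
    · rintro ⟨u, hu, h⟩
      obtain ⟨k, hk⟩ := exists_nat_ge ‖u‖
      exact ⟨k, u, ⟨hu, by simpa using hk⟩, h⟩
    · rintro ⟨k, u, ⟨hu, -⟩, h⟩
      exact ⟨u, hu, h⟩
  have hm : MeasurableSet {p : Q × E | ¬ ∀ u ∈ S, p.2 ≠ F (p.1, u)} := by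
    rw [hset]
    refine MeasurableSet.iUnion fun k => IsClosed.measurableSet ?_
    have hK : IsCompact (S ∩ Metric.closedBall (0 : E) k) :=
      (isCompact_closedBall _ _).inter_left hS
    exact isClosed_exists_mem_compact hK (F := fun q : (Q × E) × E => q.1.2 - F (q.1.1, q.2))
      (by fun_prop) 0
  rw [ae_iff, Measure.measure_prod_null hm]
  refine Filter.Eventually.of_forall fun q => ?_
  refine measure_mono_null ?_ (addHaar_image_eq_zero_of_differentiableOn_of_addHaar_eq_zero ν
    (hd q).differentiableOn h0)
  rintro x hx
  simp only [Set.mem_preimage, Set.mem_ofPred_eq, not_forall, not_not] at hx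
  obtain ⟨u, hu, h⟩ := hx
  exact ⟨u, hu, h.symm⟩

/-- With `u = (t, w)`, the row vector `x` such that `(1, w)` is a left eigenvector with generalised
eigenvalue `t` of the pair of matrices with rows `(x, A)` and `(b, B)`. -/
def eigenMap {n k : ℕ} (b : Fin k → ℝ) (B A : Matrix (Fin n) (Fin k) ℝ) (u : Fin (n + 1) → ℝ) :
    Fin k → ℝ :=
  u 0 • (b + (fun i : Fin n => u i.succ) ᵥ* B) - (fun i : Fin n => u i.succ) ᵥ* A

theorem continuous_eigenMap {X : Type*} [TopologicalSpace X] {n k : ℕ} {b : X → Fin k → ℝ}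
    {B A : X → Matrix (Fin n) (Fin k) ℝ} {u : X → Fin (n + 1) → ℝ} (hb : Continuous b)
    (hB : Continuous B) (hA : Continuous A) (hu : Continuous u) :
    Continuous fun x => eigenMap (b x) (B x) (A x) (u x) := by
  unfold eigenMap
  fun_prop

theorem insertNth_vecMul {n k : ℕ} (j : Fin (n + 1)) (a : ℝ) (w : Fin n → ℝ)
    (X : Matrix (Fin (n + 1)) (Fin k) ℝ) :
    (j.insertNth a w : Fin (n + 1) → ℝ) ᵥ* X =
      a • X j + w ᵥ* (Matrix.of fun i => X (j.succAbove i)) := by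
  ext l
  simp [Matrix.vecMul, dotProduct, Fin.sum_univ_succAbove _ j]

theorem eq_eigenMap_iff {n k : ℕ} (j : Fin (n + 1)) (X₁ X₂ : Matrix (Fin (n + 1)) (Fin k) ℝ)
    (u : Fin (n + 1) → ℝ) :
    X₁ j = eigenMap (X₂ j) (Matrix.of fun i => X₂ (j.succAbove i))
      (Matrix.of fun i => X₁ (j.succAbove i)) u ↔
    (j.insertNth 1 (fun i : Fin n => u i.succ) : Fin (n + 1) → ℝ) ᵥ* (X₁ - u 0 • X₂) = 0 := by
  rw [Matrix.vecMul_sub, Matrix.vecMul_smul, insertNth_vecMul, insertNth_vecMul, eigenMap,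
    one_smul, one_smul, sub_eq_zero, eq_sub_iff_add_eq]

theorem exists_eigenMap_of_vecMul_eq_zero {n k : ℕ} {j : Fin (n + 1)}
    {X₁ X₂ : Matrix (Fin (n + 1)) (Fin k) ℝ} {t : ℝ} {v : Fin (n + 1) → ℝ} (hj : v j ≠ 0)
    (hv : v ᵥ* (X₁ - t • X₂) = 0) :
    X₁ j = eigenMap (X₂ j) (Matrix.of fun i => X₂ (j.succAbove i))
      (Matrix.of fun i => X₁ (j.succAbove i))
      (Fin.cons t fun i => (v j)⁻¹ * v (j.succAbove i) : Fin (n + 1) → ℝ) := by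
  rw [eq_eigenMap_iff]
  have : (j.insertNth 1 (fun i : Fin n => (Fin.cons t fun i => (v j)⁻¹ * v (j.succAbove i) :
      Fin (n + 1) → ℝ) i.succ) : Fin (n + 1) → ℝ) = (v j)⁻¹ • v := by
    ext i
    refine Fin.succAboveCases j ?_ (fun i => ?_) i
    · simp [hj]
    · simp
  rw [this, Fin.cons_zero, Matrix.smul_vecMul, hv, smul_zero]

theorem differentiable_eigenMap {n k : ℕ} (b : Fin k → ℝ) (B A : Matrix (Fin n) (Fin k) ℝ) :
    Differentiable ℝ fun u => eigenMap b B A u := by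
  refine differentiable_pi.2 fun l => ?_
  simp only [eigenMap, Matrix.vecMul, dotProduct, Pi.sub_apply, Pi.smul_apply, Pi.add_apply,
    smul_eq_mul]
  fun_prop

theorem ae_ne_eigenMap {n : ℕ} (j i : Fin (n + 1)) :
    ∀ᵐ p : (Fin (n + 1) → Fin (n + 1) → ℝ) × (Fin (n + 1) → Fin (n + 1) → ℝ),
      ∀ u : Fin (n + 1) → ℝ, u i = 0 → p.1 j ≠ eigenMap (p.2 j)
        (Matrix.of fun i => p.2 (j.succAbove i)) (Matrix.of fun i => p.1 (j.succAbove i)) u := by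
  let F : (((Fin n → Fin (n + 1) → ℝ) × (Fin (n + 1) → Fin (n + 1) → ℝ)) × (Fin (n + 1) → ℝ)) →
      (Fin (n + 1) → ℝ) := fun q => eigenMap (q.1.2 j)
        (Matrix.of fun i => q.1.2 (j.succAbove i)) (Matrix.of q.1.1) q.2
  have hF : Continuous F := continuous_eigenMap (by fun_prop)
    (continuous_pi fun i => by fun_prop) (by fun_prop) (by fun_prop)
  have hS : volume {u : Fin (n + 1) → ℝ | u i = 0} = 0 :=
    Measure.pi_hyperplane _ i 0
  have h := volume_image_null (volume : Measure ((Fin n → Fin (n + 1) → ℝ) ×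
    (Fin (n + 1) → Fin (n + 1) → ℝ))) (volume : Measure (Fin (n + 1) → ℝ)) hF
    (fun q => differentiable_eigenMap (q.2 j) (Matrix.of fun i => q.2 (j.succAbove i))
      (Matrix.of q.1))
    (isClosed_eq (continuous_apply i) continuous_const : IsClosed {u : Fin (n + 1) → ℝ | u i = 0})
    hS
  have hmp : MeasurePreserving
      (fun p : (Fin (n + 1) → Fin (n + 1) → ℝ) × (Fin (n + 1) → Fin (n + 1) → ℝ) =>
        (((fun i => p.1 (j.succAbove i), p.2) : (Fin n → Fin (n + 1) → ℝ) ×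
          (Fin (n + 1) → Fin (n + 1) → ℝ)), p.1 j)) := by
    have h1 := (volume_preserving_piFinSuccAbove (fun _ : Fin (n + 1) => Fin (n + 1) → ℝ) j).prod
      (MeasurePreserving.id (volume : Measure (Fin (n + 1) → Fin (n + 1) → ℝ)))
    have h2 := Measure.measurePreserving_swap.comp ((measurePreserving_prodAssoc _ _ _).comp h1)
    exact h2
  filter_upwards [hmp.quasiMeasurePreserving.ae h] with p hp u hu
  exact hp u hu

theorem eq_zero_of_vecMul_eq_zero_of_zero {n : ℕ} {X₁ X₂ : Matrix (Fin (n + 1)) (Fin (n + 1)) ℝ}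
    (h : ∀ j i : Fin (n + 1), ∀ u : Fin (n + 1) → ℝ, u i = 0 → X₁ j ≠ eigenMap (X₂ j)
        (Matrix.of fun i => X₂ (j.succAbove i)) (Matrix.of fun i => X₁ (j.succAbove i)) u)
    {t : ℝ} {v : Fin (n + 1) → ℝ} (hv : v ᵥ* (X₁ - t • X₂) = 0) (h0 : v 0 = 0) : v = 0 := by
  by_contra hne
  obtain ⟨j, hj⟩ := Function.ne_iff.1 hne
  rw [Pi.zero_apply] at hj
  have hj0 : (0 : Fin (n + 1)) ≠ j := by
    rintro rfl
    exact hj h0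
  obtain ⟨i, hi⟩ := Fin.exists_succAbove_eq hj0
  refine h j i.succ _ ?_ (exists_eigenMap_of_vecMul_eq_zero hj hv)
  rw [Fin.cons_succ, hi, h0, mul_zero]

theorem det_ne_zero_of_ne_eigenMap {n : ℕ} {X₁ X₂ : Matrix (Fin (n + 1)) (Fin (n + 1)) ℝ}
    (h : ∀ j i : Fin (n + 1), ∀ u : Fin (n + 1) → ℝ, u i = 0 → X₁ j ≠ eigenMap (X₂ j)
        (Matrix.of fun i => X₂ (j.succAbove i)) (Matrix.of fun i => X₁ (j.succAbove i)) u) :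
    X₁.det ≠ 0 := by
  intro hdet
  obtain ⟨v, hv0, hv⟩ := Matrix.exists_vecMul_eq_zero_iff.2 hdet
  obtain ⟨j, hj⟩ := Function.ne_iff.1 hv0
  have hv' : v ᵥ* (X₁ - (0 : ℝ) • X₂) = 0 := by rwa [zero_smul, sub_zero]
  exact h j 0 _ rfl (exists_eigenMap_of_vecMul_eq_zero hj hv')

/-- Away from a null set the generalised eigenvalues correspond to the preimages of the first row
under `eigenMap`. -/
theorem count_eigenvalues_eq {n : ℕ} {X₁ X₂ : Matrix (Fin (n + 1)) (Fin (n + 1)) ℝ}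
    (h : ∀ j i : Fin (n + 1), ∀ u : Fin (n + 1) → ℝ, u i = 0 → X₁ j ≠ eigenMap (X₂ j)
        (Matrix.of fun i => X₂ (j.succAbove i)) (Matrix.of fun i => X₁ (j.succAbove i)) u) :
    Measure.count {t : ℝ | (X₁ - t • X₂).det = 0} =
      Measure.count ((eigenMap (X₂ 0) (Matrix.of fun i : Fin n => X₂ i.succ)
        (Matrix.of fun i : Fin n => X₁ i.succ)) ⁻¹' {X₁ 0}) := by
  have hcl : IsClosed {t : ℝ | (X₁ - t • X₂).det = 0} :=
    isClosed_eq (Continuous.matrix_det (by fun_prop)) continuous_const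
  have hcl' : IsClosed ((eigenMap (X₂ 0) (Matrix.of fun i : Fin n => X₂ i.succ)
        (Matrix.of fun i : Fin n => X₁ i.succ)) ⁻¹' {X₁ 0}) :=
    isClosed_singleton.preimage (continuous_eigenMap continuous_const continuous_const
      continuous_const continuous_id)
  rw [Measure.count_apply hcl.measurableSet, Measure.count_apply hcl'.measurableSet]
  have hker : ∀ u ∈ (eigenMap (X₂ 0) (Matrix.of fun i : Fin n => X₂ i.succ)
        (Matrix.of fun i : Fin n => X₁ i.succ)) ⁻¹' {X₁ 0},
      (Fin.cons 1 (fun i : Fin n => u i.succ) : Fin (n + 1) → ℝ) ᵥ* (X₁ - u 0 • X₂) = 0 := by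
    intro u hu
    have := (eq_eigenMap_iff 0 X₁ X₂ u).1 (Eq.symm hu)
    rwa [Fin.insertNth_zero'] at this
  have himg : {t : ℝ | (X₁ - t • X₂).det = 0} =
      (fun u : Fin (n + 1) → ℝ => u 0) '' ((eigenMap (X₂ 0) (Matrix.of fun i : Fin n => X₂ i.succ)
        (Matrix.of fun i : Fin n => X₁ i.succ)) ⁻¹' {X₁ 0}) := by
    ext t
    constructor
    · intro ht
      obtain ⟨v, hv0, hv⟩ := Matrix.exists_vecMul_eq_zero_iff.2 ht
      have h0 : v 0 ≠ 0 := fun h0 => hv0 (eq_zero_of_vecMul_eq_zero_of_zero h hv h0)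
      exact ⟨_, (exists_eigenMap_of_vecMul_eq_zero h0 hv).symm, rfl⟩
    · rintro ⟨u, hu, rfl⟩
      refine Matrix.exists_vecMul_eq_zero_iff.1 ⟨_, ?_, hker u hu⟩
      exact Function.ne_iff.2 ⟨0, by simp⟩
  rw [himg, Set.InjOn.encard_image]
  intro u hu u' hu' (huu : u 0 = u' 0)
  have h1 := hker u hu
  have h2 := hker u' hu'
  rw [← huu] at h2
  have h3 := eq_zero_of_vecMul_eq_zero_of_zero h
    (v := (Fin.cons 1 (fun i : Fin n => u i.succ) : Fin (n + 1) → ℝ) -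
      Fin.cons 1 (fun i : Fin n => u' i.succ)) (t := u 0)
    (by rw [Matrix.sub_vecMul, h1, h2, sub_zero]) (by simp)
  ext i
  refine Fin.cases huu (fun i => ?_) i
  have := congrFun h3 i.succ
  simpa [sub_eq_zero] using this

/-- A pencil with nonsingular first matrix has finitely many, and at most `N`, generalised
eigenvalues. -/
theorem finite_eigenvalues {N : ℕ} {X₁ X₂ : Matrix (Fin N) (Fin N) ℝ} (h : X₁.det ≠ 0) :
    {t : ℝ | (X₁ - t • X₂).det = 0}.Finite ∧ {t : ℝ | (X₁ - t • X₂).det = 0}.ncard ≤ N := by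
  classical
  set p : Polynomial ℝ := ((Polynomial.X : Polynomial ℝ) • (-X₂).map Polynomial.C +
    X₁.map Polynomial.C : Matrix (Fin N) (Fin N) (Polynomial ℝ)).det with hp
  have hp0 : p ≠ 0 := by
    intro h0
    have := Polynomial.coeff_det_X_add_C_zero (-X₂) X₁
    rw [← hp, h0, Polynomial.coeff_zero] at this
    exact h this.symm
  have hdeg : p.natDegree ≤ N := by
    simpa using Polynomial.natDegree_det_X_add_C_le (-X₂) X₁
  have heval : ∀ t, p.eval t = (X₁ - t • X₂).det := by
    intro t
    rw [hp, ← Polynomial.coe_evalRingHom, RingHom.map_det]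
    congr 1
    ext i j
    simp
    ring
  have hset : {t : ℝ | (X₁ - t • X₂).det = 0} = (p.roots.toFinset : Set ℝ) := by
    ext t
    simp [hp0, ← heval]
  rw [hset, Set.ncard_coe_finset]
  exact ⟨Finset.finite_toSet _, (Multiset.toFinset_card_le _).trans
    ((Polynomial.card_roots' p).trans hdeg)⟩

theorem ae_ne_eigenMap_all (n : ℕ) :
    ∀ᵐ p : (Fin (n + 1) → Fin (n + 1) → ℝ) × (Fin (n + 1) → Fin (n + 1) → ℝ),
      ∀ j i : Fin (n + 1), ∀ u : Fin (n + 1) → ℝ, u i = 0 → p.1 j ≠ eigenMap (p.2 j)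
        (Matrix.of fun i => p.2 (j.succAbove i)) (Matrix.of fun i => p.1 (j.succAbove i)) u :=
  ae_all_iff.2 fun j => ae_all_iff.2 fun i => ae_ne_eigenMap j i

theorem ae_det_ne_zero (n : ℕ) :
    ∀ᵐ M : Fin (n + 1) → Fin (n + 1) → ℝ, (Matrix.of M).det ≠ 0 := by
  filter_upwards [Measure.ae_ae_of_ae_prod (ae_ne_eigenMap_all n)] with M hM
  obtain ⟨X, hX⟩ := hM.exists
  exact det_ne_zero_of_ne_eigenMap (X₁ := Matrix.of M) (X₂ := Matrix.of X) hX

/-- The closed form of `meanAbsDet`. -/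
theorem meanAbsDet_mul (n : ℕ) :
    ENNReal.ofReal ((√(2 * π))⁻¹ ^ (n + 1)) * meanAbsDet (n + 1) *
      ENNReal.ofReal (√π ^ (n + 2) / Gamma (((n : ℝ) + 2) / 2)) = 1 := by
  have h1 : ∀ M : Matrix (Fin (n + 1)) (Fin (n + 1)) ℝ, M.det ≠ 0 →
      ∫⁻ z : Fin (n + 1) → ℝ, ENNReal.ofReal |M.det| * stdGaussianPDF (z ᵥ* M) = 1 := by
    intro M hM
    have hmap := Real.map_matrix_volume_pi_eq_smul_volume_pi
      (M := Mᵀ) (by rwa [Matrix.det_transpose])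
    have hc : Continuous (Matrix.toLin' Mᵀ) := LinearMap.continuous_of_finiteDimensional _
    have h := lintegral_map measurable_stdGaussianPDF hc.measurable (μ := volume)
    simp only [Matrix.toLin'_apply, Matrix.mulVec_transpose] at h
    rw [lintegral_const_mul' _ _ ENNReal.ofReal_ne_top, ← h, hmap, lintegral_smul_measure,
      lintegral_stdGaussianPDF, Matrix.det_transpose, smul_eq_mul, mul_one,
      ← ENNReal.ofReal_mul (abs_nonneg _), ← abs_mul, mul_inv_cancel₀ hM, abs_one,
      ENNReal.ofReal_one]
  have hsq := lintegral_inv_sqrt_one_add_pow (n + 1)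
  push_cast at hsq
  rw [show (n : ℝ) + 1 + 1 = n + 2 by ring] at hsq
  rw [← hsq, ← lintegral_const_mul _ (by simp only [dotProduct]; fun_prop)]
  calc _ = ∫⁻ z : Fin (n + 1) → ℝ, ∫⁻ M : Fin (n + 1) → Fin (n + 1) → ℝ,
        ENNReal.ofReal |(Matrix.of M).det| * (stdGaussianMatrixPDF (Matrix.of M) *
          stdGaussianPDF (z ᵥ* Matrix.of M)) := by
        refine lintegral_congr fun z => ?_
        obtain ⟨R, hRdet, hR⟩ := exists_sqrt_one_add_vecMulVec z
        have hz : 0 ≤ z ⬝ᵥ z := Finset.sum_nonneg fun i _ => mul_self_nonneg _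
        have hV : 0 < √(1 + z ⬝ᵥ z) := Real.sqrt_pos.2 (by positivity)
        have hR0 : R.det ≠ 0 := abs_pos.1 (hRdet ▸ hV)
        simp_rw [stdGaussianMatrixPDF_mul_vecMul hR, mul_left_comm (ENNReal.ofReal |_|)]
        rw [lintegral_const_mul' _ _ ENNReal.ofReal_ne_top,
          lintegral_absDet_mul_stdGaussianMatrixPDF hR0, hRdet, mul_assoc, mul_comm (meanAbsDet _)]
    _ = ∫⁻ M : Fin (n + 1) → Fin (n + 1) → ℝ, ∫⁻ z : Fin (n + 1) → ℝ,
        ENNReal.ofReal |(Matrix.of M).det| * (stdGaussianMatrixPDF (Matrix.of M) *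
          stdGaussianPDF (z ᵥ* Matrix.of M)) := by
        refine lintegral_lintegral_swap (Measurable.aemeasurable ?_)
        refine Measurable.mul ?_ (Measurable.mul ?_ ?_)
        · exact (Continuous.abs (Continuous.matrix_det (by fun_prop))).measurable.ennreal_ofReal
        · exact measurable_stdGaussianMatrixPDF_comp (by fun_prop)
        · exact measurable_stdGaussianPDF_comp (by fun_prop)
    _ = ∫⁻ M : Fin (n + 1) → Fin (n + 1) → ℝ, stdGaussianMatrixPDF (Matrix.of M) := by
        refine lintegral_congr_ae ?_
        filter_upwards [ae_det_ne_zero n] with M hM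
        simp_rw [mul_left_comm (ENNReal.ofReal |_|)]
        rw [lintegral_const_mul, h1 _ hM, mul_one]
        exact measurable_const.mul (measurable_stdGaussianPDF_comp (by fun_prop))
    _ = 1 := lintegral_stdGaussianMatrixPDF

/-- The map `u ↦ w ᵥ* B` for `u = (t, w)`. -/
noncomputable def tailVecMul {n k : ℕ} (B : Matrix (Fin n) (Fin k) ℝ) :
    (Fin (n + 1) → ℝ) →L[ℝ] (Fin k → ℝ) :=
  LinearMap.toContinuousLinearMap (B.vecMulLinear ∘ₗ LinearMap.funLeft ℝ ℝ Fin.succ)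

/-- The derivative of `eigenMap`. -/
noncomputable def eigenMapDeriv {n k : ℕ} (b : Fin k → ℝ) (B A : Matrix (Fin n) (Fin k) ℝ)
    (u : Fin (n + 1) → ℝ) : (Fin (n + 1) → ℝ) →L[ℝ] (Fin k → ℝ) :=
  u 0 • tailVecMul B + (ContinuousLinearMap.proj 0 : (Fin (n + 1) → ℝ) →L[ℝ] ℝ).smulRight
    (b + tailVecMul B u) - tailVecMul A

/-- The derivative of `eigenMap` is `eigenMapDeriv`. -/
theorem hasFDerivAt_eigenMap {n k : ℕ} (b : Fin k → ℝ) (B A : Matrix (Fin n) (Fin k) ℝ)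
    (u : Fin (n + 1) → ℝ) : HasFDerivAt (eigenMap b B A) (eigenMapDeriv b B A u) u :=
  (((ContinuousLinearMap.proj 0 : (Fin (n + 1) → ℝ) →L[ℝ] ℝ).hasFDerivAt).smul
    ((tailVecMul B).hasFDerivAt.const_add b)).sub (tailVecMul A).hasFDerivAt

theorem continuous_eigenMapDeriv {n k : ℕ} (b : Fin k → ℝ) (B A : Matrix (Fin n) (Fin k) ℝ) :
    Continuous (eigenMapDeriv b B A) := by
  have h : Continuous fun y : Fin k → ℝ =>
      (ContinuousLinearMap.proj 0 : (Fin (n + 1) → ℝ) →L[ℝ] ℝ).smulRight y :=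
    (ContinuousLinearMap.smulRightL ℝ (Fin (n + 1) → ℝ) (Fin k → ℝ)
      (ContinuousLinearMap.proj 0)).continuous
  have h' : Continuous fun u => b + tailVecMul B u := by fun_prop
  exact ((Continuous.smul (continuous_apply 0) continuous_const).add (h.comp h')).sub
    continuous_const

theorem det_eigenMapDeriv {n : ℕ} (b : Fin (n + 1) → ℝ) (B A : Matrix (Fin n) (Fin (n + 1)) ℝ)
    (u : Fin (n + 1) → ℝ) : (eigenMapDeriv b B A u).det =
      (consRow (b + (fun i : Fin n => u i.succ) ᵥ* B) (u 0 • B - A)).det := by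
  have h : (eigenMapDeriv b B A u : (Fin (n + 1) → ℝ) →ₗ[ℝ] (Fin (n + 1) → ℝ)) =
      Matrix.toLin' (consRow (b + (fun i : Fin n => u i.succ) ᵥ* B) (u 0 • B - A))ᵀ := by
    refine LinearMap.ext fun x => ?_
    ext l
    rw [Matrix.toLin'_apply, Matrix.mulVec_transpose]
    simp only [Matrix.vecMul, dotProduct, Fin.sum_univ_succ, consRow_zero, consRow_succ]
    change (u 0 • ((fun i : Fin n => x i.succ) ᵥ* B) +
      x 0 • (b + (fun i : Fin n => u i.succ) ᵥ* B) - (fun i : Fin n => x i.succ) ᵥ* A) l = _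
    simp only [Matrix.vecMul, dotProduct, Pi.sub_apply, Pi.add_apply, Pi.smul_apply, smul_eq_mul,
      Matrix.sub_apply, Matrix.smul_apply, mul_add, mul_sub, Finset.mul_sum,
      Finset.sum_sub_distrib, mul_left_comm]
    ring
  rw [ContinuousLinearMap.det, h, LinearMap.det_toLin', Matrix.det_transpose]

set_option synthInstance.maxSize 1000 in
theorem measurePreserving_consRow_consRow (n k : ℕ) :
    MeasurePreserving (fun q : (((Fin n → Fin k → ℝ) × (Fin k → ℝ)) × (Fin n → Fin k → ℝ)) ×
      (Fin k → ℝ) => (((fun i => consRow q.2 (Matrix.of q.1.2) i,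
        fun i => consRow q.1.1.2 (Matrix.of q.1.1.1) i)) :
        (Fin (n + 1) → Fin k → ℝ) × (Fin (n + 1) → Fin k → ℝ))) := by
  have hc : MeasurePreserving (fun q : (Fin k → ℝ) × (Fin n → Fin k → ℝ) =>
      ((fun i => consRow q.1 (Matrix.of q.2) i) : Fin (n + 1) → Fin k → ℝ)) := by
    convert (volume_preserving_piFinSuccAbove (fun _ : Fin (n + 1) => Fin k → ℝ) 0).symm using 1
    ext p i j
    refine Fin.cases ?_ (fun i => ?_) i
    · simp [consRow_zero, MeasurableEquiv.piFinSuccAbove]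
    · simp [consRow_succ, MeasurableEquiv.piFinSuccAbove]
  have h1 := (MeasurePreserving.id (volume : Measure (Fin k → ℝ))).prod
    (Measure.measurePreserving_swap (μ := (volume : Measure ((Fin n → Fin k → ℝ) × (Fin k → ℝ))))
      (ν := (volume : Measure (Fin n → Fin k → ℝ))))
  have h2 := (measurePreserving_prodAssoc (volume : Measure (Fin k → ℝ))
    (volume : Measure (Fin n → Fin k → ℝ))
    (volume : Measure ((Fin n → Fin k → ℝ) × (Fin k → ℝ)))).symm
  have h3 := Measure.measurePreserving_swap
    (μ := (volume : Measure (((Fin n → Fin k → ℝ) × (Fin k → ℝ)) × (Fin n → Fin k → ℝ))))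
    (ν := (volume : Measure (Fin k → ℝ)))
  have h4 := hc.prod (hc.comp (Measure.measurePreserving_swap
    (μ := (volume : Measure (Fin n → Fin k → ℝ))) (ν := (volume : Measure (Fin k → ℝ)))))
  exact h4.comp (h2.comp (h1.comp h3))

theorem measurable_count_eigenvalues (N : ℕ) :
    Measurable fun p : (Fin N → Fin N → ℝ) × (Fin N → Fin N → ℝ) =>
      Measure.count {t : ℝ | (Matrix.of p.1 - t • Matrix.of p.2).det = 0} :=
  measurable_count_zeros (F := fun q : ((Fin N → Fin N → ℝ) × (Fin N → Fin N → ℝ)) × ℝ =>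
    (Matrix.of q.1.1 - q.2 • Matrix.of q.1.2).det) (Continuous.matrix_det (by fun_prop))

set_option synthInstance.maxSize 1000 in
/-- The expected number of real generalised eigenvalues, as a Lebesgue integral. -/
theorem lintegral_count_eigenvalues (n : ℕ) :
    ∫⁻ p : (Fin (n + 1) → Fin (n + 1) → ℝ) × (Fin (n + 1) → Fin (n + 1) → ℝ),
      stdGaussianMatrixPDF (Matrix.of p.1) * stdGaussianMatrixPDF (Matrix.of p.2) *
        Measure.count {t : ℝ | (Matrix.of p.1 - t • Matrix.of p.2).det = 0} =
      ENNReal.ofReal ((√(2 * π))⁻¹ ^ (n + 1)) * meanAbsDet (n + 1) *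
        ENNReal.ofReal (π * (√π ^ (n + 1) / Gamma (((n : ℝ) + 1) / 2))) := by
  have hmp := measurePreserving_consRow_consRow n (n + 1)
  have hGm : Measurable fun p : (Fin (n + 1) → Fin (n + 1) → ℝ) × (Fin (n + 1) → Fin (n + 1) → ℝ) =>
      stdGaussianMatrixPDF (Matrix.of p.1) * stdGaussianMatrixPDF (Matrix.of p.2) *
        Measure.count {t : ℝ | (Matrix.of p.1 - t • Matrix.of p.2).det = 0} := by
    refine Measurable.mul (Measurable.mul ?_ ?_) ?_
    · exact measurable_stdGaussianMatrixPDF_comp (by fun_prop)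
    · exact measurable_stdGaussianMatrixPDF_comp (by fun_prop)
    · exact measurable_count_eigenvalues (n + 1)
  rw [← hmp.lintegral_comp hGm]
  erw [lintegral_prod _ (hGm.comp hmp.measurable).aemeasurable]
  have hae := Measure.ae_ae_of_ae_prod (hmp.quasiMeasurePreserving.ae (ae_ne_eigenMap_all n))
  have hmeas : Measurable fun r : (((Fin n → Fin (n + 1) → ℝ) × (Fin (n + 1) → ℝ)) ×
      (Fin n → Fin (n + 1) → ℝ)) × (Fin (n + 1) → ℝ) =>
      stdGaussianPDF r.1.1.2 * stdGaussianMatrixPDF (Matrix.of r.1.1.1) *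
        stdGaussianMatrixPDF (Matrix.of r.1.2) *
        (ENNReal.ofReal |(consRow (r.1.1.2 + (fun i : Fin n => r.2 i.succ) ᵥ* Matrix.of r.1.1.1)
          (r.2 0 • Matrix.of r.1.1.1 - Matrix.of r.1.2)).det| *
          stdGaussianPDF (eigenMap r.1.1.2 (Matrix.of r.1.1.1) (Matrix.of r.1.2) r.2)) := by
    refine Measurable.mul (Measurable.mul (Measurable.mul ?_ ?_) ?_) (Measurable.mul ?_ ?_)
    · exact measurable_stdGaussianPDF_comp (by fun_prop)
    · exact measurable_stdGaussianMatrixPDF_comp (by fun_prop)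
    · exact measurable_stdGaussianMatrixPDF_comp (by fun_prop)
    · exact (Continuous.abs (Continuous.matrix_det
          (continuous_consRow (by fun_prop) (by fun_prop)))).measurable.ennreal_ofReal
    · exact measurable_stdGaussianPDF_comp
        (continuous_eigenMap (by fun_prop) (by fun_prop) (by fun_prop) (by fun_prop))
  calc _ = ∫⁻ q : (((Fin n → Fin (n + 1) → ℝ) × (Fin (n + 1) → ℝ)) × (Fin n → Fin (n + 1) → ℝ)),
      ∫⁻ u : Fin (n + 1) → ℝ, stdGaussianPDF q.1.2 * stdGaussianMatrixPDF (Matrix.of q.1.1) *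
        stdGaussianMatrixPDF (Matrix.of q.2) *
        (ENNReal.ofReal |(consRow (q.1.2 + (fun i : Fin n => u i.succ) ᵥ* Matrix.of q.1.1)
          (u 0 • Matrix.of q.1.1 - Matrix.of q.2)).det| *
          stdGaussianPDF (eigenMap q.1.2 (Matrix.of q.1.1) (Matrix.of q.2) u)) := by
        refine lintegral_congr_ae ?_
        filter_upwards [hae] with q hq
        rw [lintegral_const_mul]
        · have harea := lintegral_mul_count_preimage (volume : Measure (Fin (n + 1) → ℝ))
            (hasFDerivAt_eigenMap q.1.2 (Matrix.of q.1.1) (Matrix.of q.2))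
            (continuous_eigenMapDeriv _ _ _) measurable_stdGaussianPDF
          simp_rw [det_eigenMapDeriv] at harea
          rw [← harea, ← lintegral_const_mul']
          · refine lintegral_congr_ae ?_
            filter_upwards [hq] with x hx
            have hcount := count_eigenvalues_eq (X₁ := consRow x (Matrix.of q.2))
              (X₂ := consRow q.1.2 (Matrix.of q.1.1)) hx
            change stdGaussianMatrixPDF (consRow x (Matrix.of q.2)) *
              stdGaussianMatrixPDF (consRow q.1.2 (Matrix.of q.1.1)) *
              Measure.count {t : ℝ | (consRow x (Matrix.of q.2) -
                t • consRow q.1.2 (Matrix.of q.1.1)).det = 0} = _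
            rw [hcount, stdGaussianMatrixPDF_consRow, stdGaussianMatrixPDF_consRow]
            change _ = _ * (_ * Measure.count
              (eigenMap q.1.2 (Matrix.of q.1.1) (Matrix.of q.2) ⁻¹' {x}))
            have e : Measure.count (eigenMap (consRow q.1.2 (Matrix.of q.1.1) 0)
                (Matrix.of fun i : Fin n => consRow q.1.2 (Matrix.of q.1.1) i.succ)
                (Matrix.of fun i : Fin n => consRow x (Matrix.of q.2) i.succ) ⁻¹'
                  {consRow x (Matrix.of q.2) 0}) =
                Measure.count (eigenMap q.1.2 (Matrix.of q.1.1) (Matrix.of q.2) ⁻¹' {x}) := rfl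
            rw [e]
            ring
          · simp only [stdGaussianPDF_eq, stdGaussianMatrixPDF_eq]
            finiteness
        · exact (Measurable.mul (Continuous.abs (Continuous.matrix_det
            (continuous_consRow (by fun_prop) (by fun_prop)))).measurable.ennreal_ofReal
            (measurable_stdGaussianPDF_comp
              (continuous_eigenMap (by fun_prop) (by fun_prop) (by fun_prop) (by fun_prop))))
    _ = ∫⁻ u : Fin (n + 1) → ℝ,
      ∫⁻ q : (((Fin n → Fin (n + 1) → ℝ) × (Fin (n + 1) → ℝ)) × (Fin n → Fin (n + 1) → ℝ)),
       stdGaussianPDF q.1.2 * stdGaussianMatrixPDF (Matrix.of q.1.1) *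
        stdGaussianMatrixPDF (Matrix.of q.2) *
        (ENNReal.ofReal |(consRow (q.1.2 + (fun i : Fin n => u i.succ) ᵥ* Matrix.of q.1.1)
          (u 0 • Matrix.of q.1.1 - Matrix.of q.2)).det| *
          stdGaussianPDF (eigenMap q.1.2 (Matrix.of q.1.1) (Matrix.of q.2) u)) :=
        lintegral_lintegral_swap hmeas.aemeasurable
    _ = ∫⁻ u : Fin (n + 1) → ℝ, ENNReal.ofReal ((√(2 * π))⁻¹ ^ (n + 1)) * meanAbsDet (n + 1) *
        ENNReal.ofReal (((1 + u 0 ^ 2) * √(1 + (fun i : Fin n => u i.succ) ⬝ᵥ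
          fun i : Fin n => u i.succ) ^ (n + 1))⁻¹) := by
        refine lintegral_congr fun u => ?_
        have hu := hmeas.comp (measurable_prodMk_right (y := u))
        rw [← lintegral_kernel]
        erw [lintegral_prod _ hu.aemeasurable,
          lintegral_prod _ hu.lintegral_prod_right'.aemeasurable]
        rfl
    _ = _ := by
        rw [lintegral_const_mul _ (by simp only [dotProduct]; fun_prop), lintegral_eigen_density]

theorem ncard_eigenvalues_eq {N : ℕ} (X₁ X₂ : Matrix (Fin N) (Fin N) ℝ) :
    ({t : ℝ | (X₁ - t • X₂).det = 0}.ncard : ℝ) =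
      (Measure.count {t : ℝ | (X₁ - t • X₂).det = 0}).toReal := by
  have hcl : IsClosed {t : ℝ | (X₁ - t • X₂).det = 0} :=
    isClosed_eq (Continuous.matrix_det (by fun_prop)) continuous_const
  rw [Measure.count_apply hcl.measurableSet, Set.ncard_def]
  generalize Set.encard _ = m
  cases m <;> simp

theorem prod_pi_pi_gaussianReal_eq (n : ℕ) :
    (Measure.pi fun _ : Fin n => Measure.pi fun _ : Fin n => gaussianReal 0 1).prod
      (Measure.pi fun _ : Fin n => Measure.pi fun _ : Fin n => gaussianReal 0 1) =
      volume.withDensity fun p : (Fin n → Fin n → ℝ) × (Fin n → Fin n → ℝ) =>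
        stdGaussianMatrixPDF (Matrix.of p.1) * stdGaussianMatrixPDF (Matrix.of p.2) := by
  have hg : Measurable fun M : Fin n → Fin n → ℝ => stdGaussianMatrixPDF (Matrix.of M) :=
    measurable_stdGaussianMatrixPDF_comp (by fun_prop)
  have h := pi_pi_gaussianReal_eq (m := n) (k := n)
  change _ = volume.withDensity fun M => stdGaussianMatrixPDF (Matrix.of M) at h
  have hs : SigmaFinite ((volume : Measure (Fin n → Fin n → ℝ)).withDensity
      fun M => stdGaussianMatrixPDF (Matrix.of M)) := by
    rw [← h]; infer_instance
  rw [h, prod_withDensity hg hg]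
  rfl

theorem ae_finite_eigenvalues (n : ℕ) :
    ∀ᵐ p : (Fin (n + 1) → Fin (n + 1) → ℝ) × (Fin (n + 1) → Fin (n + 1) → ℝ),
      {t : ℝ | (Matrix.of p.1 - t • Matrix.of p.2).det = 0}.Finite ∧
        {t : ℝ | (Matrix.of p.1 - t • Matrix.of p.2).det = 0}.ncard ≤ n + 1 := by
  filter_upwards [ae_ne_eigenMap_all n] with p hp
  exact finite_eigenvalues (det_ne_zero_of_ne_eigenMap (X₁ := Matrix.of p.1)
    (X₂ := Matrix.of p.2) hp)

end GaussianMatrix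

/-- For `X₁, X₂` independent `N × N` standard real Gaussian matrices, the set of real
generalised eigenvalues `{t : det(X₁ - t X₂) = 0}` is almost surely finite with at most `N`
elements, and its expected cardinality equals `E_N = √π Γ((N+1)/2)/Γ(N/2)`. -/
theorem stmt_1 (N : ℕ) (hN : 1 ≤ N)
    (μ : Measure (Fin N → Fin N → ℝ))
    (hμ : μ = Measure.pi fun _ : Fin N => Measure.pi fun _ : Fin N => gaussianReal 0 1) :
    (∀ᵐ p ∂ μ.prod μ,
        {t : ℝ | (Matrix.of p.1 - t • Matrix.of p.2).det = 0}.Finite ∧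
          {t : ℝ | (Matrix.of p.1 - t • Matrix.of p.2).det = 0}.ncard ≤ N) ∧
      (∫ p, (({t : ℝ | (Matrix.of p.1 - t • Matrix.of p.2).det = 0}.ncard : ℝ)) ∂ μ.prod μ) =
        Real.sqrt π * Gamma (((N : ℝ) + 1) / 2) / Gamma ((N : ℝ) / 2) := by
  obtain ⟨n, rfl⟩ : ∃ n, N = n + 1 := ⟨N - 1, by omega⟩
  subst hμ
  rw [prod_pi_pi_gaussianReal_eq]
  have hae := (withDensity_absolutelyContinuous (μ := volume)
    (fun p : (Fin (n + 1) → Fin (n + 1) → ℝ) × (Fin (n + 1) → Fin (n + 1) → ℝ) =>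
      stdGaussianMatrixPDF (Matrix.of p.1) * stdGaussianMatrixPDF (Matrix.of p.2))).ae_le
    (ae_finite_eigenvalues n)
  refine ⟨hae, ?_⟩
  have hg : Measurable
      fun p : (Fin (n + 1) → Fin (n + 1) → ℝ) × (Fin (n + 1) → Fin (n + 1) → ℝ) =>
      stdGaussianMatrixPDF (Matrix.of p.1) * stdGaussianMatrixPDF (Matrix.of p.2) :=
    (measurable_stdGaussianMatrixPDF_comp (by fun_prop)).mul
      (measurable_stdGaussianMatrixPDF_comp (by fun_prop))
  have hc := measurable_count_eigenvalues (n + 1)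
  simp_rw [ncard_eigenvalues_eq]
  rw [integral_toReal hc.aemeasurable (by
      filter_upwards [hae] with p hp using Measure.count_apply_lt_top.2 hp.1),
    lintegral_withDensity_eq_lintegral_mul _ hg hc]
  simp only [Pi.mul_apply]
  rw [lintegral_count_eigenvalues, ENNReal.toReal_mul,
    ENNReal.toReal_ofReal (by positivity)]
  have hE := congrArg ENNReal.toReal (meanAbsDet_mul n)
  rw [ENNReal.toReal_mul, ENNReal.toReal_ofReal (by positivity), ENNReal.toReal_one,
    ← eq_div_iff (by positivity)] at hE
  rw [hE]
  push_cast
  rw [show (n : ℝ) + 1 + 1 = n + 2 by ring]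
  have h1 : 0 < Gamma (((n : ℝ) + 1) / 2) := Gamma_pos_of_pos (by positivity)
  have h2 : 0 < Gamma (((n : ℝ) + 2) / 2) := Gamma_pos_of_pos (by positivity)
  have h3 : 0 < √π := by positivity
  field_simp
  nth_rewrite 1 [← Real.sq_sqrt pi_pos.le]
  ring
end

section
/- Let A, B be independent 2×2 random real matrices whose entries are independent standard Gaussians (mean 0, variance 1). Then the probability that A is invertible and the matrix M = A⁻¹B has two real eigenvalues — equivalently, that (tr M)² − 4 det M ≥ 0 — equals π/4. Consequently the probability that M has no real eigenvalues equals 1 − π/4. -/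
open MeasureTheory ProbabilityTheory Real Matrix

/-- The law of a `2 × 2` matrix with independent standard Gaussian entries. -/
noncomputable def gaussianMat : Measure (Fin 2 → Fin 2 → ℝ) :=
  Measure.pi fun _ : Fin 2 => Measure.pi fun _ : Fin 2 => gaussianReal 0 1

instance : IsProbabilityMeasure gaussianMat := by
  unfold gaussianMat; infer_instance

/-- The matrix unit with entry `1` at `(i, j)`. -/
def matUnit (i j : Fin 2) : Fin 2 → Fin 2 → ℝ := Pi.single i (Pi.single j 1)

lemma charFunDual_gaussianMat (L : StrongDual ℝ (Fin 2 → Fin 2 → ℝ)) :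
    charFunDual gaussianMat L =
      Complex.exp (-((∑ i, ∑ j, (L (matUnit i j)) ^ 2 : ℝ) : ℂ) / 2) := by
  have h1 (L : StrongDual ℝ (Fin 2 → Fin 2 → ℝ)) := charFunDual_eq_pi_iff.2 (rfl : gaussianMat = _) L
  have h2 (L : StrongDual ℝ (Fin 2 → ℝ)) := charFunDual_eq_pi_iff.2
    (rfl : (Measure.pi fun _ : Fin 2 => gaussianReal 0 1) = _) L
  have h3 (L : StrongDual ℝ ℝ) :
      charFunDual (gaussianReal 0 1) L = Complex.exp (-(((L 1) ^ 2 : ℝ) : ℂ) / 2) := by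
    rw [charFunDual_eq_charFun_map_one]
    have : (L : ℝ → ℝ) = fun x => L 1 * x := by
      ext x; rw [mul_comm, ← smul_eq_mul, ← map_smul]; simp
    rw [this, gaussianReal_map_const_mul, charFun_gaussianReal]
    simp [neg_div]
  rw [h1]
  simp only [h2, h3, ← Complex.exp_sum]
  congr 1
  simp [matUnit, Fin.sum_univ_two]
  ring

lemma gaussianMat_map (T : (Fin 2 → Fin 2 → ℝ) →L[ℝ] (Fin 2 → Fin 2 → ℝ))
    (hT : ∀ L : StrongDual ℝ (Fin 2 → Fin 2 → ℝ),
      ∑ i, ∑ j, (L (T (matUnit i j))) ^ 2 = ∑ i, ∑ j, (L (matUnit i j)) ^ 2) :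
    MeasurePreserving T gaussianMat gaussianMat := by
  refine ⟨T.continuous.measurable, ?_⟩
  have : IsProbabilityMeasure (gaussianMat.map T) :=
    Measure.isProbabilityMeasure_map T.continuous.aemeasurable
  refine Measure.ext_of_charFunDual ?_
  ext L
  rw [charFunDual_map, charFunDual_gaussianMat, charFunDual_gaussianMat]
  simp only [ContinuousLinearMap.comp_apply, hT]

lemma apply_eq_sum_matUnit (L : StrongDual ℝ (Fin 2 → Fin 2 → ℝ)) (x : Fin 2 → Fin 2 → ℝ) :
    L x = x 0 0 * L (matUnit 0 0) + x 0 1 * L (matUnit 0 1) + x 1 0 * L (matUnit 1 0)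
      + x 1 1 * L (matUnit 1 1) := by
  have : x = x 0 0 • matUnit 0 0 + x 0 1 • matUnit 0 1 + x 1 0 • matUnit 1 0
      + x 1 1 • matUnit 1 1 := by
    ext i j; fin_cases i <;> fin_cases j <;> simp [matUnit]
  conv_lhs => rw [this]
  simp

/-- The Hamilton product, a matrix being read as the quaternion with its entries, row by row, as
coordinates. -/
def quatMul (a b : Fin 2 → Fin 2 → ℝ) : Fin 2 → Fin 2 → ℝ :=
  ![![a 0 0 * b 0 0 - a 0 1 * b 0 1 - a 1 0 * b 1 0 - a 1 1 * b 1 1,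
      a 0 0 * b 0 1 + a 0 1 * b 0 0 + a 1 0 * b 1 1 - a 1 1 * b 1 0],
    ![a 0 0 * b 1 0 - a 0 1 * b 1 1 + a 1 0 * b 0 0 + a 1 1 * b 0 1,
      a 0 0 * b 1 1 + a 0 1 * b 1 0 - a 1 0 * b 0 1 + a 1 1 * b 0 0]]

/-- The squared Euclidean norm of the entries. -/
def normSqMat (a : Fin 2 → Fin 2 → ℝ) : ℝ := a 0 0 ^ 2 + a 0 1 ^ 2 + a 1 0 ^ 2 + a 1 1 ^ 2

lemma measurePreserving_quatMul_left {u : Fin 2 → Fin 2 → ℝ} (hu : normSqMat u = 1) :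
    MeasurePreserving (fun x => quatMul u x) gaussianMat gaussianMat := by
  let T : (Fin 2 → Fin 2 → ℝ) →ₗ[ℝ] (Fin 2 → Fin 2 → ℝ) :=
    { toFun := quatMul u
      map_add' := fun x y => by
        ext i j; fin_cases i <;> fin_cases j <;> simp [quatMul] <;> ring
      map_smul' := fun c x => by
        ext i j; fin_cases i <;> fin_cases j <;> simp [quatMul] <;> ring }
  refine gaussianMat_map (LinearMap.toContinuousLinearMap T) fun L => ?_
  simp only [Fin.sum_univ_two, LinearMap.coe_toContinuousLinearMap']
  rw [apply_eq_sum_matUnit L (T (matUnit 0 0)), apply_eq_sum_matUnit L (T (matUnit 0 1)),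
    apply_eq_sum_matUnit L (T (matUnit 1 0)), apply_eq_sum_matUnit L (T (matUnit 1 1))]
  unfold normSqMat at hu
  simp [T, quatMul, matUnit]
  linear_combination ((L (Pi.single 0 (Pi.single 0 1))) ^ 2 + (L (Pi.single 0 (Pi.single 1 1))) ^ 2
    + (L (Pi.single 1 (Pi.single 0 1))) ^ 2 + (L (Pi.single 1 (Pi.single 1 1))) ^ 2) * hu

lemma measurePreserving_quatMul_right {u : Fin 2 → Fin 2 → ℝ} (hu : normSqMat u = 1) :
    MeasurePreserving (fun x => quatMul x u) gaussianMat gaussianMat := by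
  let T : (Fin 2 → Fin 2 → ℝ) →ₗ[ℝ] (Fin 2 → Fin 2 → ℝ) :=
    { toFun := fun x => quatMul x u
      map_add' := fun x y => by
        ext i j; fin_cases i <;> fin_cases j <;> simp [quatMul] <;> ring
      map_smul' := fun c x => by
        ext i j; fin_cases i <;> fin_cases j <;> simp [quatMul] <;> ring }
  refine gaussianMat_map (LinearMap.toContinuousLinearMap T) fun L => ?_
  simp only [Fin.sum_univ_two, LinearMap.coe_toContinuousLinearMap']
  rw [apply_eq_sum_matUnit L (T (matUnit 0 0)), apply_eq_sum_matUnit L (T (matUnit 0 1)),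
    apply_eq_sum_matUnit L (T (matUnit 1 0)), apply_eq_sum_matUnit L (T (matUnit 1 1))]
  unfold normSqMat at hu
  simp [T, quatMul, matUnit]
  linear_combination ((L (Pi.single 0 (Pi.single 0 1))) ^ 2 + (L (Pi.single 0 (Pi.single 1 1))) ^ 2
    + (L (Pi.single 1 (Pi.single 0 1))) ^ 2 + (L (Pi.single 1 (Pi.single 1 1))) ^ 2) * hu

lemma measurePreserving_transpose :
    MeasurePreserving (fun x i j => x j i) gaussianMat gaussianMat := by
  let T : (Fin 2 → Fin 2 → ℝ) →ₗ[ℝ] (Fin 2 → Fin 2 → ℝ) :=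
    { toFun := fun x i j => x j i
      map_add' := fun x y => rfl
      map_smul' := fun c x => rfl }
  refine gaussianMat_map (LinearMap.toContinuousLinearMap T) fun L => ?_
  have h (i j : Fin 2) : T (matUnit i j) = matUnit j i := by
    ext k l; fin_cases i <;> fin_cases j <;> fin_cases k <;> fin_cases l <;> simp [T, matUnit]
  simp only [LinearMap.coe_toContinuousLinearMap', h]
  exact Finset.sum_comm

/-- A matrix built from its two rows. -/
def matOfRows (p : (ℝ × ℝ) × (ℝ × ℝ)) : Fin 2 → Fin 2 → ℝ := ![![p.1.1, p.1.2], ![p.2.1, p.2.2]]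

lemma measurePreserving_matOfRows :
    MeasurePreserving matOfRows
      (((gaussianReal 0 1).prod (gaussianReal 0 1)).prod ((gaussianReal 0 1).prod (gaussianReal 0 1)))
      gaussianMat := by
  have h1 := (measurePreserving_finTwoArrow (gaussianReal 0 1)).symm
  have h2 := (measurePreserving_finTwoArrow (Measure.pi fun _ : Fin 2 => gaussianReal 0 1)).symm
  have := h2.comp (h1.prod h1)
  exact this

lemma lintegral_gaussianReal_prod_polar {F : ℝ × ℝ → ENNReal} (hF : Measurable F) :
    ∫⁻ p, F p ∂((gaussianReal 0 1).prod (gaussianReal 0 1)) =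
      ∫⁻ r in Set.Ioi (0 : ℝ), ∫⁻ θ in Set.Ioo (-π) π,
        ENNReal.ofReal (r / (2 * π) * rexp (-r ^ 2 / 2)) * F (r * cos θ, r * sin θ) := by
  have hpdf : Measurable fun p : ℝ × ℝ => gaussianPDF 0 1 p.1 * gaussianPDF 0 1 p.2 :=
    ((measurable_gaussianPDF 0 1).comp measurable_fst).mul
      ((measurable_gaussianPDF 0 1).comp measurable_snd)
  rw [gaussianReal_of_var_ne_zero 0 one_ne_zero,
    prod_withDensity (measurable_gaussianPDF 0 1) (measurable_gaussianPDF 0 1),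
    lintegral_withDensity_eq_lintegral_mul _ hpdf hF, ← Measure.volume_eq_prod,
    ← lintegral_comp_polarCoord_symm, polarCoord_target, Measure.volume_eq_prod,
    ← Measure.prod_restrict, lintegral_prod]
  · refine setLIntegral_congr_fun measurableSet_Ioi fun r hr => ?_
    refine lintegral_congr fun θ => ?_
    have hr : 0 < r := hr
    simp only [polarCoord_symm_apply, Pi.mul_apply, gaussianPDF, gaussianPDFReal, smul_eq_mul]
    rw [← mul_assoc, ← ENNReal.ofReal_mul (by positivity), ← ENNReal.ofReal_mul hr.le]
    congr 2
    have h : √(2 * π) * √(2 * π) = 2 * π := mul_self_sqrt (by positivity)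
    have he : rexp (-(r * cos θ) ^ 2 / 2) * rexp (-(r * sin θ) ^ 2 / 2) = rexp (-r ^ 2 / 2) := by
      rw [← Real.exp_add]
      congr 1
      linear_combination (-r ^ 2 / 2) * sin_sq_add_cos_sq θ
    simp only [NNReal.coe_one, mul_one, sub_zero]
    have hi : (√(2 * π))⁻¹ * (√(2 * π))⁻¹ = (2 * π)⁻¹ := by rw [← mul_inv, h]
    rw [← he, div_eq_mul_inv r, ← hi]
    ring
  · refine Measurable.aemeasurable ?_
    simp only [smul_eq_mul, polarCoord_symm_apply]
    have : Measurable fun p : ℝ × ℝ => (p.1 * cos p.2, p.1 * sin p.2) := by fun_prop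
    exact (by fun_prop : Measurable fun p : ℝ × ℝ => ENNReal.ofReal p.1).mul
      ((hpdf.mul hF).comp this)

lemma lintegral_gaussianReal_prod_radial {f : ℝ → ENNReal} (hf : Measurable f) :
    ∫⁻ p, f (p.1 ^ 2 + p.2 ^ 2) ∂((gaussianReal 0 1).prod (gaussianReal 0 1)) =
      ∫⁻ r in Set.Ioi (0 : ℝ), ENNReal.ofReal (r * rexp (-r ^ 2 / 2)) * f (r ^ 2) := by
  rw [lintegral_gaussianReal_prod_polar (F := fun p => f (p.1 ^ 2 + p.2 ^ 2)) (by fun_prop)]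
  refine setLIntegral_congr_fun measurableSet_Ioi fun r hr => ?_
  have hr : 0 < r := hr
  have (θ : ℝ) : (r * cos θ) ^ 2 + (r * sin θ) ^ 2 = r ^ 2 := by
    linear_combination r ^ 2 * sin_sq_add_cos_sq θ
  simp only [this, lintegral_const, Measure.restrict_apply_univ, Real.volume_Ioo]
  rw [mul_right_comm, ← ENNReal.ofReal_mul (by positivity)]
  congr 2
  field_simp
  ring

lemma lintegral_gaussianReal_prod_radial_eq_abs {f : ℝ → ENNReal} (hf : Measurable f) :
    ∫⁻ p, f (p.1 ^ 2 + p.2 ^ 2) ∂((gaussianReal 0 1).prod (gaussianReal 0 1)) =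
      ENNReal.ofReal √(π / 2) * ∫⁻ x, ENNReal.ofReal |x| * f (x ^ 2) ∂(gaussianReal 0 1) := by
  have key : ∫⁻ x, ENNReal.ofReal |x| * f (x ^ 2) ∂(gaussianReal 0 1) =
      2 * ∫⁻ r in Set.Ioi (0 : ℝ), ENNReal.ofReal ((√(2 * π))⁻¹) *
        (ENNReal.ofReal (r * rexp (-r ^ 2 / 2)) * f (r ^ 2)) := by
    rw [gaussianReal_of_var_ne_zero 0 one_ne_zero,
      lintegral_withDensity_eq_lintegral_mul _ (measurable_gaussianPDF 0 1) (by fun_prop),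
      ← lintegral_add_compl _ measurableSet_Ioi (A := Set.Ioi (0 : ℝ)), two_mul]
    have hpos (r : ℝ) (hr : 0 ≤ r) : (gaussianPDF 0 1 * fun x => ENNReal.ofReal |x| * f (x ^ 2)) r =
        ENNReal.ofReal ((√(2 * π))⁻¹) * (ENNReal.ofReal (r * rexp (-r ^ 2 / 2)) * f (r ^ 2)) := by
      simp only [Pi.mul_apply, gaussianPDF, gaussianPDFReal]
      rw [← mul_assoc, ← mul_assoc, ← ENNReal.ofReal_mul (by positivity),
        ← ENNReal.ofReal_mul (by positivity), abs_of_nonneg hr]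
      congr 2
      simp
      ring
    congr 1
    · exact setLIntegral_congr_fun measurableSet_Ioi fun r hr => hpos r (le_of_lt hr)
    · rw [Set.compl_Ioi, setLIntegral_congr Iio_ae_eq_Iic.symm,
        ← (Measure.measurePreserving_neg (volume : Measure ℝ)).setLIntegral_comp_preimage_emb
          (MeasurableEquiv.neg ℝ).measurableEmbedding]
      simp only [Set.neg_preimage, Set.neg_Iio, neg_zero]
      refine setLIntegral_congr_fun measurableSet_Ioi fun r hr => ?_
      rw [← hpos r (le_of_lt hr)]
      simp [gaussianPDF, gaussianPDFReal]
  rw [lintegral_gaussianReal_prod_radial hf, key, lintegral_const_mul _ (by fun_prop), ← mul_assoc,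
    ← mul_assoc]
  have : ENNReal.ofReal √(π / 2) * 2 * ENNReal.ofReal ((√(2 * π))⁻¹) = 1 := by
    rw [← ENNReal.ofReal_ofNat, ← ENNReal.ofReal_mul (by positivity),
      ← ENNReal.ofReal_mul (by positivity), ← ENNReal.ofReal_one]
    congr 1
    have : 2 * π = 2 ^ 2 * (π / 2) := by ring
    rw [this, Real.sqrt_mul (by positivity), Real.sqrt_sq (by norm_num)]
    have : √(π / 2) ≠ 0 := by positivity
    field_simp
  rw [this, one_mul]

lemma gaussianReal_prod_le_sq_add_sq {c : ℝ} (hc : 0 ≤ c) :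
    ((gaussianReal 0 1).prod (gaussianReal 0 1)) {p | c ≤ p.1 ^ 2 + p.2 ^ 2} =
      ENNReal.ofReal (rexp (-c / 2)) := by
  have hm : Measurable ((Set.Ici c).indicator (1 : ℝ → ENNReal)) :=
    measurable_one.indicator measurableSet_Ici
  have h1 : {p : ℝ × ℝ | c ≤ p.1 ^ 2 + p.2 ^ 2} =
      (fun p : ℝ × ℝ => p.1 ^ 2 + p.2 ^ 2) ⁻¹' Set.Ici c := rfl
  have hs : MeasurableSet {p : ℝ × ℝ | c ≤ p.1 ^ 2 + p.2 ^ 2} :=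
    h1 ▸ measurableSet_Ici.preimage (by fun_prop)
  rw [← lintegral_indicator_one hs]
  have h2 (p : ℝ × ℝ) : {p : ℝ × ℝ | c ≤ p.1 ^ 2 + p.2 ^ 2}.indicator (1 : ℝ × ℝ → ENNReal) p =
      (Set.Ici c).indicator (1 : ℝ → ENNReal) (p.1 ^ 2 + p.2 ^ 2) := by
    simp [Set.indicator_apply]
  simp only [h2]
  rw [lintegral_gaussianReal_prod_radial hm]
  have h3 : ∫⁻ r in Set.Ioi (0 : ℝ), ENNReal.ofReal (r * rexp (-r ^ 2 / 2)) *
      (Set.Ici c).indicator (1 : ℝ → ENNReal) (r ^ 2) =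
      ∫⁻ r in Set.Ioi √c, ENNReal.ofReal (r * rexp (-r ^ 2 / 2)) := by
    rw [← lintegral_indicator measurableSet_Ioi, ← lintegral_indicator measurableSet_Ioi]
    refine lintegral_congr_ae ?_
    filter_upwards [Measure.ae_ne volume √c] with r hr
    by_cases h : √c < r
    · have h0 : 0 < r := (Real.sqrt_nonneg c).trans_lt h
      have : c ≤ r ^ 2 := ((Real.sqrt_lt' h0).1 h).le
      simp [Set.indicator_apply, h, h0, this]
    · have h' : r < √c := lt_of_le_of_ne (not_lt.1 h) hr
      by_cases h0 : 0 < r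
      · have : ¬ c ≤ r ^ 2 := not_le.2 ((Real.lt_sqrt h0.le).1 h')
        simp [Set.indicator_apply, h, this]
      · simp [Set.indicator_apply, h, h0]
  have hd (r : ℝ) : HasDerivAt (fun r => -rexp (-r ^ 2 / 2)) (r * rexp (-r ^ 2 / 2)) r := by
    have := ((((hasDerivAt_id r).pow 2).neg.div_const 2).exp).neg
    convert! this using 1
    simp
    ring
  have hlim : Filter.Tendsto (fun r : ℝ => -rexp (-r ^ 2 / 2)) Filter.atTop (nhds 0) := by
    rw [← neg_zero]
    refine (Real.tendsto_exp_atBot.comp ?_).neg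
    have : Filter.Tendsto (fun r : ℝ => r ^ 2 / 2) Filter.atTop Filter.atTop :=
      (Filter.tendsto_pow_atTop two_ne_zero).atTop_div_const two_pos
    refine (Filter.tendsto_neg_atTop_atBot.comp this).congr fun r => ?_
    simp [neg_div]
  have hnn (r : ℝ) (hr : r ∈ Set.Ioi √c) : 0 ≤ r * rexp (-r ^ 2 / 2) :=
    mul_nonneg ((Real.sqrt_nonneg c).trans (le_of_lt hr)) (Real.exp_nonneg _)
  have hint := integrableOn_Ioi_deriv_of_nonneg' (fun r _ => hd r) hnn hlim
  rw [h3, ← ofReal_integral_eq_lintegral_ofReal hint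
    ((ae_restrict_iff' measurableSet_Ioi).2 (Filter.Eventually.of_forall hnn)),
    integral_Ioi_of_hasDerivAt_of_nonneg' (fun r _ => hd r) hnn hlim]
  simp [Real.sq_sqrt hc]

lemma lintegral_exp_neg_mul_sq_gaussianReal {k : ℝ} (hk : 0 ≤ k) :
    ∫⁻ x, ENNReal.ofReal (rexp (-(k * x ^ 2) / 2)) ∂(gaussianReal 0 1) =
      ENNReal.ofReal (√(1 + k))⁻¹ := by
  have hb : 0 < (1 + k) / 2 := by positivity
  rw [gaussianReal_of_var_ne_zero 0 one_ne_zero,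
    lintegral_withDensity_eq_lintegral_mul _ (measurable_gaussianPDF 0 1) (by fun_prop)]
  have h (x : ℝ) : (gaussianPDF 0 1 * fun x => ENNReal.ofReal (rexp (-(k * x ^ 2) / 2))) x =
      ENNReal.ofReal ((√(2 * π))⁻¹ * rexp (-((1 + k) / 2) * x ^ 2)) := by
    simp only [Pi.mul_apply, gaussianPDF, gaussianPDFReal]
    rw [← ENNReal.ofReal_mul (by positivity), mul_assoc, ← Real.exp_add]
    simp
    ring_nf
  simp only [h]
  rw [← ofReal_integral_eq_lintegral_ofReal ((integrable_exp_neg_mul_sq hb).const_mul _)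
    (Filter.Eventually.of_forall fun x => by positivity), integral_const_mul, integral_gaussian]
  congr 1
  have : π / ((1 + k) / 2) = 2 * π / (1 + k) := by field_simp
  rw [this, Real.sqrt_div (by positivity)]
  field_simp

lemma lintegral_sq_mul_sq_div_gaussianReal :
    ∫⁻ p, ENNReal.ofReal (p.1 ^ 2 * p.2 ^ 2 / (p.1 ^ 2 + p.2 ^ 2))
      ∂((gaussianReal 0 1).prod (gaussianReal 0 1)) = ENNReal.ofReal (1 / 4) := by
  have hang : ∫⁻ θ in Set.Ioo (-π) π, ENNReal.ofReal (sin θ ^ 2 * cos θ ^ 2) =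
      ENNReal.ofReal (π / 4) := by
    rw [← ofReal_integral_eq_lintegral_ofReal
      ((by fun_prop : Continuous fun θ => sin θ ^ 2 * cos θ ^ 2).integrableOn_Icc.mono_set
        Set.Ioo_subset_Icc_self)
      (Filter.Eventually.of_forall fun x => by positivity), ← integral_Ioc_eq_integral_Ioo,
      ← intervalIntegral.integral_of_le (by linarith [pi_pos]), integral_sin_sq_mul_cos_sq]
    congr 1
    have h4 : sin (4 * π) = 0 := by exact_mod_cast sin_nat_mul_pi 4
    rw [mul_neg, sin_neg, h4]
    ring
  have hrad : ∫⁻ r in Set.Ioi (0 : ℝ), ENNReal.ofReal (r ^ 3 * rexp (-r ^ 2 / 2)) =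
      ENNReal.ofReal 2 := by
    have h1 (r : ℝ) (hr : r ∈ Set.Ioi (0 : ℝ)) :
        r ^ 3 * rexp (-r ^ 2 / 2) = r ^ (3 : ℝ) * rexp (-(1 / 2) * r ^ (2 : ℝ)) := by
      norm_cast
      ring_nf
    have h2 : ∫ r in Set.Ioi (0 : ℝ), r ^ 3 * rexp (-r ^ 2 / 2) = 2 := by
      rw [setIntegral_congr_fun measurableSet_Ioi h1,
        integral_rpow_mul_exp_neg_mul_rpow (by norm_num) (by norm_num) (by norm_num)]
      norm_num
    rw [← ofReal_integral_eq_lintegral_ofReal, h2]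
    · exact not_imp_comm.1 integral_undef (by rw [h2]; norm_num)
    · refine (ae_restrict_iff' measurableSet_Ioi).2 (Filter.Eventually.of_forall fun r hr => ?_)
      exact mul_nonneg (pow_nonneg (le_of_lt hr) 3) (Real.exp_nonneg _)
  rw [lintegral_gaussianReal_prod_polar (by fun_prop)]
  have h (r : ℝ) (hr : r ∈ Set.Ioi (0 : ℝ)) : ∫⁻ θ in Set.Ioo (-π) π,
      ENNReal.ofReal (r / (2 * π) * rexp (-r ^ 2 / 2)) *
        ENNReal.ofReal ((r * cos θ) ^ 2 * (r * sin θ) ^ 2 / ((r * cos θ) ^ 2 + (r * sin θ) ^ 2)) =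
      ENNReal.ofReal (1 / 8) * ENNReal.ofReal (r ^ 3 * rexp (-r ^ 2 / 2)) := by
    have hr : 0 < r := hr
    have h1 (θ : ℝ) : ENNReal.ofReal (r / (2 * π) * rexp (-r ^ 2 / 2)) *
        ENNReal.ofReal ((r * cos θ) ^ 2 * (r * sin θ) ^ 2 / ((r * cos θ) ^ 2 + (r * sin θ) ^ 2)) =
        ENNReal.ofReal (r ^ 3 / (2 * π) * rexp (-r ^ 2 / 2)) *
          ENNReal.ofReal (sin θ ^ 2 * cos θ ^ 2) := by
      rw [← ENNReal.ofReal_mul (by positivity), ← ENNReal.ofReal_mul (by positivity)]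
      congr 1
      have : (r * cos θ) ^ 2 + (r * sin θ) ^ 2 = r ^ 2 := by
        linear_combination r ^ 2 * sin_sq_add_cos_sq θ
      rw [this]
      field_simp
    simp only [h1]
    rw [lintegral_const_mul _ (by fun_prop), hang, ← ENNReal.ofReal_mul (by positivity),
      ← ENNReal.ofReal_mul (by positivity)]
    congr 1
    field_simp
    norm_num
  rw [setLIntegral_congr_fun measurableSet_Ioi h, lintegral_const_mul _ (by fun_prop), hrad,
    ← ENNReal.ofReal_mul (by positivity)]
  norm_num

/-- The discriminant of the binary quadratic form `det (x A + y B)`. -/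
def pencilDisc (a b : Fin 2 → Fin 2 → ℝ) : ℝ :=
  (a 1 1 * b 0 0 - a 0 1 * b 1 0 + a 0 0 * b 1 1 - a 1 0 * b 0 1) ^ 2 -
    4 * (a 0 0 * a 1 1 - a 0 1 * a 1 0) * (b 0 0 * b 1 1 - b 0 1 * b 1 0)

lemma trace_sq_sub_det_inv_mul (a b : Fin 2 → Fin 2 → ℝ) (ha : (Matrix.of a).det ≠ 0) :
    (Matrix.trace ((Matrix.of a)⁻¹ * Matrix.of b)) ^ 2 -
      4 * ((Matrix.of a)⁻¹ * Matrix.of b).det = pencilDisc a b / (Matrix.of a).det ^ 2 := by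
  rw [Matrix.det_mul, Matrix.det_nonsing_inv, Ring.inverse_eq_inv', Matrix.inv_def,
    Ring.inverse_eq_inv', Matrix.adjugate_fin_two]
  rw [eq_div_iff (pow_ne_zero 2 ha), Matrix.trace_fin_two]
  simp only [Matrix.smul_apply, smul_eq_mul, Matrix.mul_apply, Fin.sum_univ_two]
  have h : (Matrix.of a).det⁻¹ * (Matrix.of a).det = 1 := inv_mul_cancel₀ ha
  generalize (Matrix.of a).det⁻¹ = d at h
  simp [pencilDisc, Matrix.det_fin_two] at h ⊢
  grind

/-- The component along `i` of the quaternion `b * n * conj b`. -/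
def rotatedComponent (n b : Fin 2 → Fin 2 → ℝ) : ℝ :=
  n 0 1 * (b 0 0 ^ 2 + b 0 1 ^ 2 - b 1 0 ^ 2 - b 1 1 ^ 2) +
    2 * n 1 0 * (b 0 1 * b 1 0 - b 0 0 * b 1 1) + 2 * n 1 1 * (b 0 1 * b 1 1 + b 0 0 * b 1 0)

lemma pencilDisc_quatMul (n b : Fin 2 → Fin 2 → ℝ) :
    pencilDisc (quatMul b n) b =
      normSqMat b ^ 2 * (n 0 1 ^ 2 + n 1 1 ^ 2) - rotatedComponent n b ^ 2 := by
  simp [pencilDisc, quatMul, normSqMat, rotatedComponent]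
  ring

lemma pencilDisc_smul_left (c : ℝ) (a b : Fin 2 → Fin 2 → ℝ) :
    pencilDisc (c • a) b = c ^ 2 * pencilDisc a b := by
  simp [pencilDisc]
  ring

lemma quatMul_smul_left (c : ℝ) (a b : Fin 2 → Fin 2 → ℝ) :
    quatMul (c • a) b = c • quatMul a b := by
  ext i j; fin_cases i <;> fin_cases j <;> simp [quatMul] <;> ring

lemma normSqMat_smul (c : ℝ) (a : Fin 2 → Fin 2 → ℝ) : normSqMat (c • a) = c ^ 2 * normSqMat a := by
  simp [normSqMat]
  ring

lemma normSqMat_inv_sqrt_smul {a : Fin 2 → Fin 2 → ℝ} (ha : 0 < normSqMat a) :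
    normSqMat ((√(normSqMat a))⁻¹ • a) = 1 := by
  rw [normSqMat_smul, inv_pow, Real.sq_sqrt ha.le, inv_mul_cancel₀ ha.ne']

lemma normSqMat_pos {a : Fin 2 → Fin 2 → ℝ} {i j : Fin 2} (h : a i j ≠ 0) : 0 < normSqMat a := by
  have := sq_pos_of_ne_zero h
  unfold normSqMat
  fin_cases i <;> fin_cases j <;> simp at this <;> positivity

lemma ae_entry_ne_zero (i j : Fin 2) : ∀ᵐ x ∂gaussianMat, x i j ≠ 0 := by
  have h := (measurePreserving_eval (fun _ : Fin 2 => gaussianReal 0 1) j).comp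
    (measurePreserving_eval (fun _ : Fin 2 => Measure.pi fun _ : Fin 2 => gaussianReal 0 1) i)
  have := nullSingletonClass_gaussianReal (μ := 0) (one_ne_zero : (1 : NNReal) ≠ 0)
  exact h.quasiMeasurePreserving.ae (Measure.ae_ne (gaussianReal 0 1) 0)

lemma ae_det_ne_zero_s2 : ∀ᵐ x ∂gaussianMat, (Matrix.of x).det ≠ 0 := by
  have := nullSingletonClass_gaussianReal (μ := 0) (one_ne_zero : (1 : NNReal) ≠ 0)
  have hm : Measurable fun x : Fin 2 → Fin 2 → ℝ => (Matrix.of x).det := by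
    simp only [Matrix.det_fin_two, Matrix.of_apply]
    fun_prop
  have hs : MeasurableSet {x : Fin 2 → Fin 2 → ℝ | (Matrix.of x).det = 0} :=
    measurableSet_eq_fun hm measurable_const
  rw [ae_iff]
  simp only [not_not]
  rw [← measurePreserving_matOfRows.measure_preimage hs.nullMeasurableSet]
  rw [Measure.measure_prod_null (measurePreserving_matOfRows.measurable hs)]
  have h1 : ∀ᵐ p : ℝ × ℝ ∂((gaussianReal 0 1).prod (gaussianReal 0 1)), p.1 ≠ 0 :=
    Measure.quasiMeasurePreserving_fst.ae (Measure.ae_ne (gaussianReal 0 1) 0)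
  filter_upwards [h1] with p hp
  simp only [Pi.zero_apply]
  rw [Measure.measure_prod_null (measurable_prodMk_left (measurePreserving_matOfRows.measurable hs))]
  refine Filter.Eventually.of_forall fun c => ?_
  refine measure_mono_null (t := {p.2 * c / p.1}) (fun d hd => ?_) (measure_singleton _)
  simp [matOfRows, Matrix.det_fin_two] at hd
  rw [Set.mem_singleton_iff, eq_div_iff hp]
  linarith

lemma gaussianMat_pencilDisc_left {b : Fin 2 → Fin 2 → ℝ} (hb : 0 < normSqMat b) :
    gaussianMat {a | 0 ≤ pencilDisc a b} =
      gaussianMat {n | rotatedComponent n b ^ 2 ≤ normSqMat b ^ 2 * (n 0 1 ^ 2 + n 1 1 ^ 2)} := by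
  have hs : MeasurableSet {a | 0 ≤ pencilDisc a b} :=
    measurableSet_le measurable_const (by unfold pencilDisc; fun_prop)
  rw [← (measurePreserving_quatMul_left (normSqMat_inv_sqrt_smul hb)).measure_preimage
    hs.nullMeasurableSet]
  congr 1
  ext n
  have : 0 < (√(normSqMat b))⁻¹ ^ 2 := by positivity
  simp only [Set.mem_preimage, Set.mem_ofPred_eq]
  rw [quatMul_smul_left, pencilDisc_smul_left, pencilDisc_quatMul,
    mul_nonneg_iff_of_pos_left this, sub_nonneg]

lemma gaussianMat_rotatedComponent {n : Fin 2 → Fin 2 → ℝ} (hn : n 1 0 ≠ 0) :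
    gaussianMat {b | rotatedComponent n b ^ 2 ≤ normSqMat b ^ 2 * (n 0 1 ^ 2 + n 1 1 ^ 2)} =
      gaussianMat {b | (n 0 1 ^ 2 + n 1 0 ^ 2 + n 1 1 ^ 2) *
        (b 0 0 ^ 2 + b 0 1 ^ 2 - (b 1 0 ^ 2 + b 1 1 ^ 2)) ^ 2 ≤
          normSqMat b ^ 2 * (n 0 1 ^ 2 + n 1 1 ^ 2)} := by
  set m := √(n 0 1 ^ 2 + n 1 0 ^ 2 + n 1 1 ^ 2) with hm
  have hm2 : m ^ 2 = n 0 1 ^ 2 + n 1 0 ^ 2 + n 1 1 ^ 2 := Real.sq_sqrt (by positivity)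
  let w : Fin 2 → Fin 2 → ℝ := ![![0, n 0 1 + m], ![n 1 0, n 1 1]]
  have hw : 0 < normSqMat w := normSqMat_pos (i := 1) (j := 0) (by simpa [w] using hn)
  have hs : MeasurableSet
      {b | rotatedComponent n b ^ 2 ≤ normSqMat b ^ 2 * (n 0 1 ^ 2 + n 1 1 ^ 2)} :=
    measurableSet_le (by unfold rotatedComponent; fun_prop) (by unfold normSqMat; fun_prop)
  rw [← (measurePreserving_quatMul_right (normSqMat_inv_sqrt_smul hw)).measure_preimage
    hs.nullMeasurableSet]
  congr 1
  ext b
  simp only [Set.mem_preimage, Set.mem_ofPred_eq]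
  set c := (√(normSqMat w))⁻¹ with hc
  have hcw : c ^ 2 * normSqMat w = 1 := by
    rw [hc, inv_pow, Real.sq_sqrt hw.le, inv_mul_cancel₀ hw.ne']
  have h1 : normSqMat (quatMul b (c • w)) = normSqMat b := by
    have : normSqMat (quatMul b (c • w)) = c ^ 2 * normSqMat w * normSqMat b := by
      simp [normSqMat, quatMul]
      ring
    rw [this, hcw, one_mul]
  have h2 : rotatedComponent n (quatMul b (c • w)) =
      m * (b 0 0 ^ 2 + b 0 1 ^ 2 - (b 1 0 ^ 2 + b 1 1 ^ 2)) := by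
    have : rotatedComponent n (quatMul b (c • w)) =
        c ^ 2 * normSqMat w * (m * (b 0 0 ^ 2 + b 0 1 ^ 2 - (b 1 0 ^ 2 + b 1 1 ^ 2))) := by
      simp [normSqMat, rotatedComponent, quatMul, w]
      grind
    rw [this, hcw, one_mul]
  rw [h1, h2, mul_pow, hm2]

lemma gaussianMat_quadratic {S T : ℝ} (hS : 0 < S) (hT : 0 < T) :
    gaussianMat {n | (n 0 1 ^ 2 + n 1 0 ^ 2 + n 1 1 ^ 2) * (S - T) ^ 2 ≤
        (S + T) ^ 2 * (n 0 1 ^ 2 + n 1 1 ^ 2)} =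
      ENNReal.ofReal (2 * (√S * √T) / (S + T)) := by
  set k := (S - T) ^ 2 / (4 * S * T) with hk
  have hk0 : 0 ≤ k := by positivity
  have hset (n : Fin 2 → Fin 2 → ℝ) : (n 0 1 ^ 2 + n 1 0 ^ 2 + n 1 1 ^ 2) * (S - T) ^ 2 ≤
        (S + T) ^ 2 * (n 0 1 ^ 2 + n 1 1 ^ 2) ↔ k * n 1 0 ^ 2 ≤ n 0 1 ^ 2 + n 1 1 ^ 2 := by
    rw [hk, div_mul_eq_mul_div, div_le_iff₀ (by positivity)]
    constructor <;> intro h <;> nlinarith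
  simp only [hset]
  have hs : MeasurableSet {n : Fin 2 → Fin 2 → ℝ | k * n 1 0 ^ 2 ≤ n 0 1 ^ 2 + n 1 1 ^ 2} :=
    measurableSet_le (by fun_prop) (by fun_prop)
  have hmp := measurePreserving_transpose.comp measurePreserving_matOfRows
  rw [← hmp.measure_preimage hs.nullMeasurableSet, Measure.prod_apply (hmp.measurable hs)]
  have hslice (p : ℝ × ℝ) : ((gaussianReal 0 1).prod (gaussianReal 0 1))
      (Prod.mk p ⁻¹' (((fun (x : Fin 2 → Fin 2 → ℝ) i j => x j i) ∘ matOfRows) ⁻¹'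
        {n : Fin 2 → Fin 2 → ℝ | k * n 1 0 ^ 2 ≤ n 0 1 ^ 2 + n 1 1 ^ 2})) =
      ENNReal.ofReal (rexp (-(k * p.2 ^ 2) / 2)) := by
    rw [← gaussianReal_prod_le_sq_add_sq (by positivity)]
    rfl
  simp only [hslice]
  rw [lintegral_prod_symm _ (by fun_prop)]
  simp only [lintegral_const, measure_univ, mul_one]
  rw [lintegral_exp_neg_mul_sq_gaussianReal hk0]
  congr 1
  have h1 : 1 + k = ((S + T) / (2 * (√S * √T))) ^ 2 := by
    rw [div_pow, mul_pow, mul_pow, Real.sq_sqrt hS.le, Real.sq_sqrt hT.le, hk]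
    field_simp
    ring
  rw [h1, Real.sqrt_sq (by positivity), inv_div]

lemma lintegral_gaussianMat_rows :
    ∫⁻ b, ENNReal.ofReal (2 * (√(b 0 0 ^ 2 + b 0 1 ^ 2) * √(b 1 0 ^ 2 + b 1 1 ^ 2)) /
      (b 0 0 ^ 2 + b 0 1 ^ 2 + (b 1 0 ^ 2 + b 1 1 ^ 2))) ∂gaussianMat =
      ENNReal.ofReal (π / 4) := by
  rw [← measurePreserving_matOfRows.lintegral_comp (by fun_prop)]
  have hinner (s : ℝ) : ∫⁻ q, ENNReal.ofReal (2 * (√s * √(q.1 ^ 2 + q.2 ^ 2)) /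
      (s + (q.1 ^ 2 + q.2 ^ 2))) ∂((gaussianReal 0 1).prod (gaussianReal 0 1)) =
      ENNReal.ofReal √(π / 2) * ∫⁻ y, ENNReal.ofReal |y| *
        ENNReal.ofReal (2 * (√s * √(y ^ 2)) / (s + y ^ 2)) ∂(gaussianReal 0 1) :=
    lintegral_gaussianReal_prod_radial_eq_abs
      (f := fun t => ENNReal.ofReal (2 * (√s * √t) / (s + t))) (by fun_prop)
  rw [lintegral_prod _ (by unfold matOfRows; fun_prop)]
  simp only [matOfRows, Matrix.cons_val_zero, Matrix.cons_val_one, hinner]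
  rw [lintegral_gaussianReal_prod_radial_eq_abs (f := fun s => ENNReal.ofReal √(π / 2) *
    ∫⁻ y, ENNReal.ofReal |y| * ENNReal.ofReal (2 * (√s * √(y ^ 2)) / (s + y ^ 2))
      ∂(gaussianReal 0 1)) (by fun_prop)]
  have hpt (x y : ℝ) : ENNReal.ofReal |x| * (ENNReal.ofReal √(π / 2) * (ENNReal.ofReal |y| *
      ENNReal.ofReal (2 * (√(x ^ 2) * √(y ^ 2)) / (x ^ 2 + y ^ 2)))) =
      ENNReal.ofReal (2 * √(π / 2)) * ENNReal.ofReal (x ^ 2 * y ^ 2 / (x ^ 2 + y ^ 2)) := by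
    rw [← ENNReal.ofReal_mul (by positivity), ← ENNReal.ofReal_mul (by positivity),
      ← ENNReal.ofReal_mul (by positivity), ← ENNReal.ofReal_mul (by positivity)]
    congr 1
    rw [Real.sqrt_sq_eq_abs, Real.sqrt_sq_eq_abs, ← sq_abs x, ← sq_abs y]
    ring
  have hmul (x : ℝ) : ENNReal.ofReal |x| * (ENNReal.ofReal √(π / 2) * ∫⁻ y, ENNReal.ofReal |y| *
      ENNReal.ofReal (2 * (√(x ^ 2) * √(y ^ 2)) / (x ^ 2 + y ^ 2)) ∂(gaussianReal 0 1)) =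
      ENNReal.ofReal (2 * √(π / 2)) *
        ∫⁻ y, ENNReal.ofReal (x ^ 2 * y ^ 2 / (x ^ 2 + y ^ 2)) ∂(gaussianReal 0 1) := by
    rw [← lintegral_const_mul _ (by fun_prop), ← lintegral_const_mul _ (by fun_prop),
      ← lintegral_const_mul _ (by fun_prop)]
    exact lintegral_congr fun y => hpt x y
  simp only [hmul]
  have hq := lintegral_sq_mul_sq_div_gaussianReal
  rw [lintegral_prod _ (by fun_prop)] at hq
  rw [lintegral_const_mul _ (by fun_prop), hq, ← ENNReal.ofReal_mul (by positivity),
    ← ENNReal.ofReal_mul (by positivity)]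
  congr 1
  have : √(π / 2) * √(π / 2) = π / 2 := Real.mul_self_sqrt (by positivity)
  linear_combination this / 2

lemma gaussianMat_prod_pencilDisc :
    (gaussianMat.prod gaussianMat) {p | 0 ≤ pencilDisc p.1 p.2} = ENNReal.ofReal (π / 4) := by
  have hs1 : MeasurableSet {p : (Fin 2 → Fin 2 → ℝ) × (Fin 2 → Fin 2 → ℝ) |
      0 ≤ pencilDisc p.1 p.2} :=
    measurableSet_le measurable_const (by unfold pencilDisc; fun_prop)
  have hs2 : MeasurableSet {p : (Fin 2 → Fin 2 → ℝ) × (Fin 2 → Fin 2 → ℝ) |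
      rotatedComponent p.1 p.2 ^ 2 ≤ normSqMat p.2 ^ 2 * (p.1 0 1 ^ 2 + p.1 1 1 ^ 2)} :=
    measurableSet_le (by unfold rotatedComponent; fun_prop) (by unfold normSqMat; fun_prop)
  have hs3 : MeasurableSet {p : (Fin 2 → Fin 2 → ℝ) × (Fin 2 → Fin 2 → ℝ) |
      (p.1 0 1 ^ 2 + p.1 1 0 ^ 2 + p.1 1 1 ^ 2) *
        (p.2 0 0 ^ 2 + p.2 0 1 ^ 2 - (p.2 1 0 ^ 2 + p.2 1 1 ^ 2)) ^ 2 ≤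
          normSqMat p.2 ^ 2 * (p.1 0 1 ^ 2 + p.1 1 1 ^ 2)} :=
    measurableSet_le (by fun_prop) (by unfold normSqMat; fun_prop)
  calc
    _ = ∫⁻ b, gaussianMat {a | 0 ≤ pencilDisc a b} ∂gaussianMat := Measure.prod_apply_symm hs1
    _ = ∫⁻ b, gaussianMat {n | rotatedComponent n b ^ 2 ≤
          normSqMat b ^ 2 * (n 0 1 ^ 2 + n 1 1 ^ 2)} ∂gaussianMat := by
      refine lintegral_congr_ae ?_
      filter_upwards [ae_entry_ne_zero 0 0] with b hb
      exact gaussianMat_pencilDisc_left (normSqMat_pos hb)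
    _ = ∫⁻ n, gaussianMat {b | rotatedComponent n b ^ 2 ≤
          normSqMat b ^ 2 * (n 0 1 ^ 2 + n 1 1 ^ 2)} ∂gaussianMat :=
      (Measure.prod_apply_symm hs2).symm.trans (Measure.prod_apply hs2)
    _ = ∫⁻ n, gaussianMat {b | (n 0 1 ^ 2 + n 1 0 ^ 2 + n 1 1 ^ 2) *
          (b 0 0 ^ 2 + b 0 1 ^ 2 - (b 1 0 ^ 2 + b 1 1 ^ 2)) ^ 2 ≤
            normSqMat b ^ 2 * (n 0 1 ^ 2 + n 1 1 ^ 2)} ∂gaussianMat := by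
      refine lintegral_congr_ae ?_
      filter_upwards [ae_entry_ne_zero 1 0] with n hn
      exact gaussianMat_rotatedComponent hn
    _ = ∫⁻ b, gaussianMat {n | (n 0 1 ^ 2 + n 1 0 ^ 2 + n 1 1 ^ 2) *
          (b 0 0 ^ 2 + b 0 1 ^ 2 - (b 1 0 ^ 2 + b 1 1 ^ 2)) ^ 2 ≤
            normSqMat b ^ 2 * (n 0 1 ^ 2 + n 1 1 ^ 2)} ∂gaussianMat :=
      (Measure.prod_apply hs3).symm.trans (Measure.prod_apply_symm hs3)
    _ = ∫⁻ b, ENNReal.ofReal (2 * (√(b 0 0 ^ 2 + b 0 1 ^ 2) * √(b 1 0 ^ 2 + b 1 1 ^ 2)) /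
          (b 0 0 ^ 2 + b 0 1 ^ 2 + (b 1 0 ^ 2 + b 1 1 ^ 2))) ∂gaussianMat := by
      refine lintegral_congr_ae ?_
      filter_upwards [ae_entry_ne_zero 0 0, ae_entry_ne_zero 1 0] with b h0 h1
      rw [← gaussianMat_quadratic (by positivity) (by positivity)]
      simp only [normSqMat, add_assoc]
    _ = _ := lintegral_gaussianMat_rows

/-- For `A, B` independent `2 × 2` standard real Gaussian matrices, the probability that `A`
is invertible and `M = A⁻¹ B` has two real eigenvalues (i.e. `(tr M)² - 4 det M ≥ 0`) equals
`π/4`; consequently the probability that `M` has no real eigenvalues equals `1 - π/4`. -/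
theorem stmt_2
    (μ : Measure (Fin 2 → Fin 2 → ℝ))
    (hμ : μ = Measure.pi fun _ : Fin 2 => Measure.pi fun _ : Fin 2 => gaussianReal 0 1) :
    (μ.prod μ) {p : (Fin 2 → Fin 2 → ℝ) × (Fin 2 → Fin 2 → ℝ) |
        IsUnit (Matrix.of p.1).det ∧
          0 ≤ (Matrix.trace ((Matrix.of p.1)⁻¹ * Matrix.of p.2)) ^ 2 -
              4 * ((Matrix.of p.1)⁻¹ * Matrix.of p.2).det} = ENNReal.ofReal (π / 4) ∧
    (μ.prod μ) {p : (Fin 2 → Fin 2 → ℝ) × (Fin 2 → Fin 2 → ℝ) |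
        IsUnit (Matrix.of p.1).det ∧
          (Matrix.trace ((Matrix.of p.1)⁻¹ * Matrix.of p.2)) ^ 2 -
              4 * ((Matrix.of p.1)⁻¹ * Matrix.of p.2).det < 0} =
      ENNReal.ofReal (1 - π / 4) := by
  have hμ' : μ = gaussianMat := hμ
  subst hμ'
  have hdet : ∀ᵐ p : (Fin 2 → Fin 2 → ℝ) × (Fin 2 → Fin 2 → ℝ) ∂(gaussianMat.prod gaussianMat),
      (Matrix.of p.1).det ≠ 0 :=
    Measure.quasiMeasurePreserving_fst.ae ae_det_ne_zero_s2
  have hs : MeasurableSet {p : (Fin 2 → Fin 2 → ℝ) × (Fin 2 → Fin 2 → ℝ) |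
      0 ≤ pencilDisc p.1 p.2} :=
    measurableSet_le measurable_const (by unfold pencilDisc; fun_prop)
  constructor
  · rw [← gaussianMat_prod_pencilDisc]
    refine measure_congr (Filter.eventuallyEq_set.2 ?_)
    filter_upwards [hdet] with p hp
    have : 0 < (Matrix.of p.1).det ^ 2 := by positivity
    rw [trace_sq_sub_det_inv_mul _ _ hp, le_div_iff₀ this, zero_mul]
    exact and_iff_right hp.isUnit
  · rw [ENNReal.ofReal_sub _ (by positivity), ENNReal.ofReal_one, ← gaussianMat_prod_pencilDisc,
      ← prob_compl_eq_one_sub hs]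
    refine measure_congr (Filter.eventuallyEq_set.2 ?_)
    filter_upwards [hdet] with p hp
    have : 0 < (Matrix.of p.1).det ^ 2 := by positivity
    rw [Set.mem_compl_iff, Set.mem_ofPred_eq, not_le, trace_sq_sub_det_inv_mul _ _ hp,
      div_lt_iff₀ this, zero_mul]
    exact and_iff_right hp.isUnit
end

section
/- Let N ≥ 2 be an even integer and set c_N = Γ((N+1)/2)/(2·Γ(N/2+1)). For integers a, b with 0 ≤ a, b ≤ N−1 define A(a,b) = −(i/2)·c_N·∫_0^{2π} ∫_0^{2π} exp(i(a − (N−1)/2)θ₁) · exp(i(b − (N−1)/2)θ₂) · sgn(θ₂ − θ₁) dθ₂ dθ₁. Then A(a,b) = 0 whenever a + b ≠ N − 1, and for every integer j with 0 ≤ j ≤ N/2 − 1, A(2j, N−1−2j) = (2π/(N−1−4j)) · Γ((N+1)/2)/Γ(N/2+1). -/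
open MeasureTheory Real intervalIntegral

/-- Integrating a continuous function against `sign (θ - t)` splits the interval at `t`. -/
theorem integral_mul_sign_sub {f : ℝ → ℂ} (hf : Continuous f) {a b t : ℝ}
    (hat : a ≤ t) (htb : t ≤ b) :
    ∫ θ in a..b, f θ * ((Real.sign (θ - t) : ℝ) : ℂ) =
      (∫ θ in t..b, f θ) - ∫ θ in a..t, f θ := by
  have hl : Set.EqOn (fun θ => -f θ) (fun θ => f θ * ((Real.sign (θ - t) : ℝ) : ℂ))
      (Set.Ioo a t) := by
    intro θ hθ
    simp [Real.sign_of_neg (sub_neg.2 hθ.2)]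
  have hr : Set.EqOn f (fun θ => f θ * ((Real.sign (θ - t) : ℝ) : ℂ)) (Set.Ioo t b) := by
    intro θ hθ
    simp [Real.sign_of_pos (sub_pos.2 hθ.1)]
  have il : IntervalIntegrable (fun θ => f θ * ((Real.sign (θ - t) : ℝ) : ℂ)) volume a t :=
    (hf.neg.intervalIntegrable a t).congr_uIoo (by rwa [Set.uIoo_of_le hat])
  have ir : IntervalIntegrable (fun θ => f θ * ((Real.sign (θ - t) : ℝ) : ℂ)) volume t b :=
    (hf.intervalIntegrable t b).congr_uIoo (by rwa [Set.uIoo_of_le htb])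
  rw [← integral_add_adjacent_intervals il ir,
    ← integral_congr_Ioo_of_le hat hl, ← integral_congr_Ioo_of_le htb hr, intervalIntegral.integral_neg]
  ring

/-- The integral of a character `θ ↦ exp (i q θ)` with nonzero frequency. -/
theorem integral_exp_I_mul {q : ℝ} (hq : q ≠ 0) (a b : ℝ) :
    ∫ θ in a..b, Complex.exp (Complex.I * ((q * θ : ℝ) : ℂ)) =
      (Complex.exp (Complex.I * ((q * b : ℝ) : ℂ)) -
        Complex.exp (Complex.I * ((q * a : ℝ) : ℂ))) / (Complex.I * q) := by
  have h : Complex.I * (q : ℂ) ≠ 0 := mul_ne_zero Complex.I_ne_zero (by exact_mod_cast hq)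
  have := integral_exp_mul_complex (a := a) (b := b) h
  simpa [mul_assoc] using this

/-- The sign transform of an antiperiodic character is a multiple of that character. -/
theorem integral_exp_mul_sign_of_antiperiodic {q t : ℝ} (hq : q ≠ 0)
    (hq' : Complex.exp (Complex.I * ((q * (2 * π) : ℝ) : ℂ)) = -1)
    (h0 : 0 ≤ t) (h1 : t ≤ 2 * π) :
    ∫ θ in (0 : ℝ)..(2 * π), Complex.exp (Complex.I * ((q * θ : ℝ) : ℂ)) *
        ((Real.sign (θ - t) : ℝ) : ℂ) =
      2 * Complex.I / q * Complex.exp (Complex.I * ((q * t : ℝ) : ℂ)) := by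
  have hqc : (q : ℂ) ≠ 0 := by exact_mod_cast hq
  rw [integral_mul_sign_sub (by fun_prop) h0 h1, integral_exp_I_mul hq, integral_exp_I_mul hq, hq']
  simp only [mul_zero, Complex.ofReal_zero, Complex.exp_zero]
  field_simp
  rw [Complex.I_sq]
  ring

/-- The double integral of two characters against the sign kernel reduces to a single integral. -/
theorem integral_integral_exp_mul_exp_mul_sign (p : ℝ) {q : ℝ} (hq : q ≠ 0)
    (hq' : Complex.exp (Complex.I * ((q * (2 * π) : ℝ) : ℂ)) = -1) :
    ∫ θ₁ in (0 : ℝ)..(2 * π), ∫ θ₂ in (0 : ℝ)..(2 * π),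
        Complex.exp (Complex.I * ((p * θ₁ : ℝ) : ℂ)) *
        Complex.exp (Complex.I * ((q * θ₂ : ℝ) : ℂ)) *
        ((Real.sign (θ₂ - θ₁) : ℝ) : ℂ) =
      2 * Complex.I / q *
        ∫ θ in (0 : ℝ)..(2 * π), Complex.exp (Complex.I * (((p + q) * θ : ℝ) : ℂ)) := by
  rw [← intervalIntegral.integral_const_mul]
  refine intervalIntegral.integral_congr fun t ht => ?_
  rw [Set.uIcc_of_le (by positivity)] at ht
  simp only [mul_assoc (Complex.exp _), intervalIntegral.integral_const_mul]
  rw [integral_exp_mul_sign_of_antiperiodic hq hq' ht.1 ht.2, mul_left_comm, ← Complex.exp_add]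
  push_cast
  ring_nf

/-- The integral over a full period of a character with nonzero integer frequency vanishes. -/
theorem integral_exp_I_int_mul {k : ℤ} (hk : k ≠ 0) :
    ∫ θ in (0 : ℝ)..(2 * π), Complex.exp (Complex.I * (((k : ℝ) * θ : ℝ) : ℂ)) = 0 := by
  rw [integral_exp_I_mul (by exact_mod_cast hk)]
  have : Complex.I * (((k : ℝ) * (2 * π) : ℝ) : ℂ) = k * (2 * π * Complex.I) := by
    push_cast; ring
  rw [this, Complex.exp_int_mul_two_pi_mul_I]
  simp

/-- Half-integer frequencies are antiperiodic on `[0, 2π]`. -/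
theorem exp_I_half_odd_mul_two_pi {m : ℤ} (hm : Odd m) :
    Complex.exp (Complex.I * (((m : ℝ) / 2 * (2 * π) : ℝ) : ℂ)) = -1 := by
  obtain ⟨k, rfl⟩ := hm
  have : Complex.I * ((((2 * k + 1 : ℤ) : ℝ) / 2 * (2 * π) : ℝ) : ℂ) =
      k * (2 * π * Complex.I) + π * Complex.I := by
    push_cast; ring
  rw [this, Complex.exp_add, Complex.exp_int_mul_two_pi_mul_I, Complex.exp_pi_mul_I, one_mul]

open MeasureTheory Real intervalIntegral

/-- Skew-orthogonality of the monomials for the real spherical ensemble, `N` even: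
the circle inner products `A(a,b) = ⟨x^a, x^b⟩_r` vanish unless `a + b = N - 1`, and
`A(2j, N-1-2j) = (2π/(N-1-4j)) Γ((N+1)/2)/Γ(N/2+1)`. -/
theorem stmt_5 (N : ℕ) (hN : 2 ≤ N) (hNe : Even N)
    (cN : ℝ) (hcN : cN = Gamma (((N : ℝ) + 1) / 2) / (2 * Gamma ((N : ℝ) / 2 + 1)))
    (A : ℕ → ℕ → ℂ)
    (hA : ∀ a b : ℕ, A a b = -(Complex.I / 2) * (cN : ℂ) *
      ∫ θ₁ in (0:ℝ)..(2 * π), ∫ θ₂ in (0:ℝ)..(2 * π),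
        Complex.exp (Complex.I * ((((a : ℝ) - ((N : ℝ) - 1) / 2) * θ₁ : ℝ) : ℂ)) *
        Complex.exp (Complex.I * ((((b : ℝ) - ((N : ℝ) - 1) / 2) * θ₂ : ℝ) : ℂ)) *
        ((Real.sign (θ₂ - θ₁) : ℝ) : ℂ)) :
    (∀ a b : ℕ, a ≤ N - 1 → b ≤ N - 1 → a + b ≠ N - 1 → A a b = 0) ∧
    (∀ j : ℕ, j ≤ N / 2 - 1 →
      A (2 * j) (N - 1 - 2 * j) =
        (((2 * π / ((N : ℝ) - 1 - 4 * j)) *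
            Gamma (((N : ℝ) + 1) / 2) / Gamma ((N : ℝ) / 2 + 1) : ℝ) : ℂ)) := by
  have key : ∀ a b : ℕ, A a b = cN / ((((2 * b - (N - 1) : ℤ) : ℝ) / 2 : ℝ) : ℂ) *
      ∫ θ in (0 : ℝ)..(2 * π),
        Complex.exp (Complex.I * ((((a + b - (N - 1) : ℤ) : ℝ) * θ : ℝ) : ℂ)) := by
    intro a b
    have hodd : Odd (2 * b - (N - 1) : ℤ) := by
      obtain ⟨k, rfl⟩ := hNe
      exact ⟨b - k, by push_cast; ring⟩
    have hne : (((2 * b - (N - 1) : ℤ) : ℝ) / 2) ≠ 0 := by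
      have : (2 * b - (N - 1) : ℤ) ≠ 0 := by
        rintro h
        simp [h] at hodd
      exact div_ne_zero (by exact_mod_cast this) two_ne_zero
    have hb : (b : ℝ) - ((N : ℝ) - 1) / 2 = ((2 * b - (N - 1) : ℤ) : ℝ) / 2 := by
      push_cast; ring
    have hab : (a : ℝ) - ((N : ℝ) - 1) / 2 + ((2 * b - (N - 1) : ℤ) : ℝ) / 2 =
        ((a + b - (N - 1) : ℤ) : ℝ) := by
      push_cast; ring
    rw [hA, hb, integral_integral_exp_mul_exp_mul_sign _ hne (exp_I_half_odd_mul_two_pi hodd), hab]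
    linear_combination (-(cN : ℂ) / ((((2 * b - (N - 1) : ℤ) : ℝ) / 2 : ℝ) : ℂ) *
      ∫ θ in (0 : ℝ)..(2 * π),
        Complex.exp (Complex.I * ((((a + b - (N - 1) : ℤ) : ℝ) * θ : ℝ) : ℂ))) * Complex.I_sq
  refine ⟨fun a b _ _ hab => ?_, fun j hj => ?_⟩
  · rw [key, integral_exp_I_int_mul (by omega), mul_zero]
  · have hb : ((N - 1 - 2 * j : ℕ) : ℤ) = N - 1 - 2 * j := by omega
    have h0 : ((2 * j : ℕ) + (N - 1 - 2 * j : ℕ) - (N - 1) : ℤ) = 0 := by omega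
    have h1 : (2 * (N - 1 - 2 * j : ℕ) - (N - 1) : ℤ) = N - 1 - 4 * j := by omega
    have h2 : (N - 1 - 4 * j : ℤ) ≠ 0 := by
      obtain ⟨k, rfl⟩ := hNe
      omega
    have h3 : (N : ℂ) - 1 - 4 * j ≠ 0 := by exact_mod_cast h2
    have hG : ((Gamma ((N : ℝ) / 2 + 1) : ℝ) : ℂ) ≠ 0 := by
      exact_mod_cast (Real.Gamma_pos_of_pos (by positivity)).ne'
    rw [key, h0, h1, hcN]
    simp only [Int.cast_zero, zero_mul, Complex.ofReal_zero, mul_zero, Complex.exp_zero,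
      intervalIntegral.integral_const, sub_zero, Complex.real_smul, mul_one]
    generalize Gamma ((N : ℝ) / 2 + 1) = G at hG ⊢
    generalize Gamma (((N : ℝ) + 1) / 2) = H
    push_cast
    field_simp
end
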